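/- There exists ε > 0 with B_ε ⊆ U such that for every x ∈ B_ε with x ≠ 0, F(x) = 0, and dF(x) : ℝ^M → ℝ^N surjective, the point x does not belong to the Milnor set M(F); equivalently, near the origin the smooth part V_F \ Sing F of the zero set of F is transverse to every sphere centered at the origin, i.e., M(F) ∩ (V_F \ Sing F) ∩ (B_ε \ {0}) = ∅. -/

import Mathlib

open Metric Set Function Topology

noncomputable section

/-- The singular set of a map: points where the total derivative is not surjective. -/
def Sing {E F : Type*} [NormedAddCommGroup E] [NormedSpace ℝ E] [NormedAddCommGroup F]
    [NormedSpace ℝ F] (P : E → F) : Set E :=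
  {x | ¬ Function.Surjective ⇑(fderiv ℝ P x)}

/-- The Milnor set of a map (with respect to the Euclidean distance `‖x‖²`):
points where the derivative of `x ↦ (P x, ‖x‖²)` is not surjective. -/
def MilnorSet {E F : Type*} [NormedAddCommGroup E] [NormedSpace ℝ E] [NormedAddCommGroup F]
    [NormedSpace ℝ F] (P : E → F) : Set E :=
  {x | ¬ Function.Surjective ⇑(fderiv ℝ (fun y => (P y, ‖y‖ ^ 2)) x)}

/-- Tameness: as set germs at the origin, `closure(M(P) \ Sing P) ∩ Sing P ⊆ {0}`. -/
def Tame {E F : Type*} [NormedAddCommGroup E] [NormedSpace ℝ E] [NormedAddCommGroup F]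
    [NormedSpace ℝ F] (P : E → F) : Prop :=
  ∃ ε > 0, closure ((MilnorSet P \ Sing P) ∩ ball (0 : E) ε) ∩ Sing P ∩ ball (0 : E) ε ⊆ {0}

namespace MilnorAux

open Filter

/-- Euclidean space of dimension `n`. -/
abbrev Eu (n : ℕ) := EuclideanSpace ℝ (Fin n)

/-- Monomials. -/
def mon {n : ℕ} (α : Fin n → ℕ) (x : Fin n → ℝ) : ℝ := ∏ i, x i ^ α i

lemma mon_add {n : ℕ} (α β : Fin n → ℕ) (x : Fin n → ℝ) :
    mon (α + β) x = mon α x * mon β x := by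
  simp [mon, pow_add, Finset.prod_mul_distrib]

lemma mon_mul {n : ℕ} (α : Fin n → ℕ) (x y : Fin n → ℝ) :
    mon α (fun i => x i * y i) = mon α x * mon α y := by
  simp [mon, mul_pow, Finset.prod_mul_distrib]

lemma mon_abs_le {n : ℕ} (α : Fin n → ℕ) (x r : Fin n → ℝ) (h : ∀ i, |x i| ≤ r i) :
    |mon α x| ≤ mon α r := by
  simp only [mon, Finset.abs_prod, abs_pow]
  exact Finset.prod_le_prod (fun i _ => by positivity)
    (fun i _ => pow_le_pow_left₀ (abs_nonneg _) (h i) _)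

lemma mon_const {n : ℕ} (α : Fin n → ℕ) (r : ℝ) : mon α (fun _ => r) = r ^ (∑ i, α i) := by
  simp [mon, Finset.prod_pow_eq_pow_sum]

lemma mon_nonneg {n : ℕ} (α : Fin n → ℕ) (r : Fin n → ℝ) (h : ∀ i, 0 ≤ r i) : 0 ≤ mon α r :=
  Finset.prod_nonneg (fun i _ => pow_nonneg (h i) _)

lemma mon_pos {n : ℕ} (α : Fin n → ℕ) (r : Fin n → ℝ) (h : ∀ i, 0 < r i) : 0 < mon α r :=
  Finset.prod_pos (fun i _ => pow_pos (h i) _)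

/-- `f` is given by the power series with coefficients `a` on the polydisc of radius `r`. -/
structure Rep {n : ℕ} (f : Eu n → ℝ) (a : (Fin n → ℕ) → ℝ) (r : ℝ) : Prop where
  pos : 0 < r
  summ : Summable fun α => |a α| * mon α (fun _ => r)
  eq : ∀ x : Eu n, (∀ i, |x i| ≤ r) → f x = ∑' α, a α * mon α x.ofLp

lemma summable_of_le {n : ℕ} {a : (Fin n → ℕ) → ℝ} {r : Fin n → ℝ}
    (h : Summable fun α => |a α| * mon α r) (x : Fin n → ℝ) (hx : ∀ i, |x i| ≤ r i) :
    Summable fun α => a α * mon α x := by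
  refine Summable.of_norm_bounded h fun α => ?_
  rw [Real.norm_eq_abs, abs_mul]
  exact mul_le_mul_of_nonneg_left (mon_abs_le _ _ _ hx) (abs_nonneg _)

lemma exists_word {n : ℕ} (α : Fin n → ℕ) (k : ℕ) (hk : ∑ i, α i = k) :
    ∃ w : Fin k → Fin n, ∀ x : Fin n → ℝ, ∏ j, x (w j) = mon α x := by
  subst hk
  refine ⟨fun j => (finSigmaFinEquiv.symm j).1, fun x => ?_⟩
  rw [Equiv.prod_comp finSigmaFinEquiv.symm (fun s : (i : Fin n) × Fin (α i) => x s.1),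
    Fintype.prod_sigma]
  simp [mon]

lemma exists_multilin {n : ℕ} (α : Fin n → ℕ) (k : ℕ) (hk : ∑ i, α i = k) :
    ∃ m : ContinuousMultilinearMap ℝ (fun _ : Fin k => Eu n) ℝ, ‖m‖ ≤ 1 ∧
      ∀ x : Eu n, m (fun _ => x) = mon α x.ofLp := by
  obtain ⟨w, hw⟩ := exists_word α k hk
  refine ⟨(ContinuousMultilinearMap.mkPiAlgebraFin ℝ k ℝ).compContinuousLinearMap
    (fun j => EuclideanSpace.proj (w j)), ?_, fun x => ?_⟩
  · refine ContinuousMultilinearMap.opNorm_le_bound zero_le_one fun m => ?_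
    simp only [ContinuousMultilinearMap.compContinuousLinearMap_apply,
      ContinuousMultilinearMap.mkPiAlgebraFin_apply, one_mul]
    rw [List.prod_ofFn, norm_prod]
    exact Finset.prod_le_prod (fun _ _ => norm_nonneg _) (fun i _ => PiLp.norm_apply_le _ _)
  · simp only [ContinuousMultilinearMap.compContinuousLinearMap_apply,
      ContinuousMultilinearMap.mkPiAlgebraFin_apply]
    rw [List.prod_ofFn, ← hw]
    rfl

lemma Rep.analyticAt {n : ℕ} {f : Eu n → ℝ} {a : (Fin n → ℕ) → ℝ} {r : ℝ} (h : Rep f a r) :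
    AnalyticAt ℝ f 0 := by
  classical
  have hm : ∀ α : Fin n → ℕ, ∀ k, ∃ m : ContinuousMultilinearMap ℝ (fun _ : Fin k => Eu n) ℝ,
      ∑ i, α i = k → (‖m‖ ≤ 1 ∧ ∀ x : Eu n, m (fun _ => x) = mon α x.ofLp) := by
    intro α k
    by_cases hk : ∑ i, α i = k
    · obtain ⟨m, h⟩ := exists_multilin α k hk
      exact ⟨m, fun _ => h⟩
    · exact ⟨0, fun h => absurd h hk⟩
  choose m hm using hm
  let p : FormalMultilinearSeries ℝ (Eu n) ℝ := fun k =>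
    ∑ α ∈ Finset.piAntidiag Finset.univ k, a α • m α k
  have hp : ∀ k, ∀ x : Eu n, p k (fun _ => x) =
      ∑ α ∈ Finset.piAntidiag Finset.univ k, a α * mon α x.ofLp := by
    intro k x
    simp only [p, _root_.sum_apply, _root_.smul_apply,
      smul_eq_mul]
    refine Finset.sum_congr rfl fun α hα => ?_
    rw [(hm α k (by simpa using hα)).2]
  have hfib : ∀ (u : (Fin n → ℕ) → ℝ) (k : ℕ),
      ∑' b : ((fun α : Fin n → ℕ => ∑ i, α i) ⁻¹' {k}), u b =
        ∑ α ∈ Finset.piAntidiag Finset.univ k, u α := by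
    intro u k
    have : ((fun α : Fin n → ℕ => ∑ i, α i) ⁻¹' {k}) =
        ((Finset.piAntidiag Finset.univ k : Finset (Fin n → ℕ)) : Set (Fin n → ℕ)) := by
      ext α; simp
    rw [this]
    exact Finset.tsum_subtype _ _
  refine ⟨p, ENNReal.ofReal r, ?_, ?_, ?_⟩
  · refine p.le_radius_of_bound (∑' α, |a α| * mon α (fun _ => r)) fun k => ?_
    rw [Real.coe_toNNReal r h.pos.le]
    calc ‖p k‖ * r ^ k ≤ (∑ α ∈ Finset.piAntidiag Finset.univ k, |a α|) * r ^ k := by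
          refine mul_le_mul_of_nonneg_right ?_ (pow_nonneg h.pos.le _)
          refine (norm_sum_le _ _).trans (Finset.sum_le_sum fun α hα => ?_)
          rw [norm_smul, Real.norm_eq_abs]
          exact mul_le_of_le_one_right (abs_nonneg _) (hm α k (by simpa using hα)).1
      _ = ∑ α ∈ Finset.piAntidiag Finset.univ k, |a α| * mon α (fun _ => r) := by
          rw [Finset.sum_mul]
          refine Finset.sum_congr rfl fun α hα => ?_
          rw [mon_const, show ∑ i, α i = k by simpa using hα]
      _ ≤ _ := h.summ.sum_le_tsum _ fun α _ =>
          mul_nonneg (abs_nonneg _) (mon_nonneg _ _ fun _ => h.pos.le)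
  · simpa using h.pos
  · intro y hy
    have hy' : ∀ i, |y i| ≤ r := by
      intro i
      have h1 : ‖y‖ < r := by
        rw [Metric.eball_ofReal] at hy
        simpa using hy
      exact (PiLp.norm_apply_le y i).trans h1.le
    have hs := (summable_of_le h.summ y.ofLp hy').hasSum
    rw [zero_add, h.eq y hy']
    have := hs.tsum_fiberwise (fun α : Fin n → ℕ => ∑ i, α i)
    simp only [hp]
    convert this using 2 with k
    rw [hfib (fun α => a α * mon α y.ofLp)]

lemma prod_word {n k : ℕ} (w : Fin k → Fin n) (x : Fin n → ℝ) :
    ∏ j, x (w j) = mon (fun i => (Finset.univ.filter fun j => w j = i).card) x := by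
  classical
  rw [mon, ← Finset.prod_fiberwise Finset.univ w]
  refine Finset.prod_congr rfl fun i _ => ?_
  rw [Finset.prod_congr rfl (g := fun _ => x i)]
  · simp
  · intro j hj
    rw [(Finset.mem_filter.1 hj).2]

lemma exists_rep {n : ℕ} {f : Eu n → ℝ} (hf : AnalyticAt ℝ f 0) : ∃ a r, Rep f a r := by
  classical
  obtain ⟨p, hp⟩ := hf
  obtain ⟨C, s, hC, hs, hb⟩ := p.le_mul_pow_of_radius_pos hp.radius_pos
  obtain ⟨ρ, hρ, hball⟩ := Metric.eventually_nhds_iff.1 hp.eventually_hasSum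
  -- choose the radius
  obtain ⟨r, hr, hr1, hr2⟩ : ∃ r : ℝ, 0 < r ∧ (n : ℝ) * s * r < 1 ∧
      ∀ x : Eu n, (∀ i, |x i| ≤ r) → dist x 0 < ρ := by
    have h1 : ∀ᶠ r : ℝ in 𝓝 0, (n : ℝ) * s * r < 1 := by
      have : Tendsto (fun r : ℝ => (n : ℝ) * s * r) (𝓝 0) (𝓝 ((n : ℝ) * s * 0)) :=
        (continuous_const.mul continuous_id).tendsto _
      rw [mul_zero] at this
      exact this.eventually (gt_mem_nhds one_pos)
    have h2 : ∀ᶠ r : ℝ in 𝓝 0, √(n : ℝ) * r < ρ := by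
      have : Tendsto (fun r : ℝ => √(n : ℝ) * r) (𝓝 0) (𝓝 (√(n : ℝ) * 0)) :=
        (continuous_const.mul continuous_id).tendsto _
      rw [mul_zero] at this
      exact this.eventually (gt_mem_nhds hρ)
    have h3 : ∀ᶠ r : ℝ in 𝓝[>] 0, 0 < r := eventually_mem_nhdsWithin
    obtain ⟨r, ⟨h1, h2⟩, h3⟩ :=
      (((h1.and h2).filter_mono nhdsWithin_le_nhds).and h3).exists
    refine ⟨r, h3, h1, fun x hx => lt_of_le_of_lt ?_ h2⟩
    rw [dist_zero_right, EuclideanSpace.norm_eq]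
    rw [Real.sqrt_le_left (by positivity), mul_pow, Real.sq_sqrt (by positivity)]
    calc ∑ i, ‖x i‖ ^ 2 ≤ ∑ i : Fin n, r ^ 2 :=
          Finset.sum_le_sum fun i _ => pow_le_pow_left₀ (norm_nonneg _) (hx i) 2
      _ = _ := by simp
  let W := (k : ℕ) × (Fin k → Fin n)
  let e : Fin n → Eu n := fun i => EuclideanSpace.single i 1
  let c : W → ℝ := fun w => p w.1 (fun j => e (w.2 j))
  let ty : W → (Fin n → ℕ) := fun w i => (Finset.univ.filter fun j => w.2 j = i).card
  have hexp : ∀ k, ∀ x : Eu n, p k (fun _ => x) =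
      ∑ w : Fin k → Fin n, c ⟨k, w⟩ * mon (ty ⟨k, w⟩) x.ofLp := by
    intro k x
    have hx : x = ∑ i, x i • e i := by
      have := (EuclideanSpace.basisFun (Fin n) ℝ).sum_repr x
      simpa [e] using this.symm
    conv_lhs => rw [hx]
    rw [ContinuousMultilinearMap.map_sum (p k) (fun _ i => x i • e i)]
    refine Finset.sum_congr rfl fun w _ => ?_
    rw [ContinuousMultilinearMap.map_smul_univ, prod_word w x.ofLp, smul_eq_mul, mul_comm]
  have hcb : ∀ w : W, |c w| ≤ C * s ^ w.1 := by
    intro w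
    refine ((p w.1).le_opNorm _).trans ?_
    simpa [e] using hb w.1
  have hty : ∀ w : W, mon (ty w) (fun _ => r) = r ^ w.1 := by
    intro w
    rw [← prod_word w.2]
    simp
  have hS : Summable fun w : W => |c w| * mon (ty w) (fun _ => r) := by
    refine Summable.of_nonneg_of_le (fun w => mul_nonneg (abs_nonneg _)
      (mon_nonneg _ _ fun _ => hr.le)) (fun w => ?_)
      (f := fun w : W => C * s ^ w.1 * r ^ w.1) ?_
    · rw [hty]
      exact mul_le_mul_of_nonneg_right (hcb w) (by positivity)
    · rw [summable_sigma_of_nonneg (fun w => by positivity)]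
      refine ⟨fun k => Summable.of_finite, ?_⟩
      simp only [tsum_fintype, Finset.sum_const, Finset.card_univ, Fintype.card_fun,
        Fintype.card_fin, nsmul_eq_mul]
      have : Summable fun k : ℕ => C * ((n : ℝ) * s * r) ^ k :=
        (summable_geometric_of_lt_one (by positivity) hr1).mul_left C
      refine this.congr fun k => ?_
      push_cast
      ring
  have hfibsum : ∀ β : Fin n → ℕ, ∀ x : Fin n → ℝ,
      ∑' w : (ty ⁻¹' {β}), c w * mon (ty w) x = (∑' w : (ty ⁻¹' {β}), c w) * mon β x := by
    intro β x
    rw [← tsum_mul_right]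
    refine tsum_congr fun w => ?_
    have : ty w = β := w.2
    rw [this]
  refine ⟨fun β => ∑' w : (ty ⁻¹' {β}), c w, r, hr, ?_, fun x hx => ?_⟩
  · have h1 := (hS.hasSum.tsum_fiberwise ty).summable
    refine Summable.of_nonneg_of_le (fun β => mul_nonneg (abs_nonneg _)
      (mon_nonneg _ _ fun _ => hr.le)) (fun β => ?_) h1
    have hnn := mon_nonneg β (fun _ => r) fun _ => hr.le
    conv_lhs => rw [← abs_of_nonneg hnn, ← abs_mul, ← hfibsum]
    have h2 : Summable fun w : (ty ⁻¹' {β}) => ‖c w * mon (ty w) (fun _ => r)‖ := by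
      refine (hS.comp_injective Subtype.val_injective).congr fun w => ?_
      simp only [comp]
      rw [norm_mul, Real.norm_eq_abs, Real.norm_eq_abs,
        abs_of_nonneg (mon_nonneg _ (fun _ => r) fun _ => hr.le)]
    refine (norm_tsum_le_tsum_norm h2).trans (le_of_eq (tsum_congr fun w => ?_))
    rw [norm_mul, Real.norm_eq_abs, Real.norm_eq_abs,
        abs_of_nonneg (mon_nonneg _ (fun _ => r) fun _ => hr.le)]
  · have hsw : Summable fun w : W => c w * mon (ty w) x.ofLp := by
      refine Summable.of_norm_bounded hS fun w => ?_
      rw [norm_mul]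
      exact mul_le_mul_of_nonneg_left (mon_abs_le _ _ _ hx) (abs_nonneg _)
    have h1 := hball (hr2 x hx)
    rw [zero_add] at h1
    have h2 : HasSum (fun k => p k (fun _ => x)) (∑' w : W, c w * mon (ty w) x.ofLp) := by
      have := hsw.hasSum.sigma (g := fun k => p k (fun _ => x)) (fun k => by
        rw [hexp]; exact hasSum_fintype _)
      exact this
    rw [h1.unique h2]
    have h3 := (hsw.hasSum.tsum_fiberwise ty).tsum_eq
    rw [← h3]
    exact tsum_congr fun β => hfibsum β _


/-- The space of absolutely summable families. -/
abbrev X1 (n : ℕ) := lp (fun _ : (Fin n → ℕ) => ℝ) 1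

lemma X1_summ {n : ℕ} (v : X1 n) : Summable fun α => |v α| := by
  have := (lp.memℓp v).summable (by simp)
  simpa using this

lemma X1_norm {n : ℕ} (v : X1 n) : ‖v‖ = ∑' α, |v α| := by
  rw [lp.norm_eq_tsum_rpow (by simp)]
  simp

/-- The element of `X1` given by a summable family. -/
def toX1 {n : ℕ} (a : (Fin n → ℕ) → ℝ) (h : Summable fun α => |a α|) : X1 n :=
  ⟨a, memℓp_gen (by simpa using h)⟩

@[simp] lemma toX1_apply {n : ℕ} (a : (Fin n → ℕ) → ℝ) (h : Summable fun α => |a α|) (α) :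
    toX1 a h α = a α := rfl

lemma sumL_summ {n : ℕ} {B : Type*} [NormedAddCommGroup B] [NormedSpace ℝ B] [CompleteSpace B]
    (T : (Fin n → ℕ) → B) (C : ℝ) (hT : ∀ γ, ‖T γ‖ ≤ C) (h : X1 n) :
    Summable fun γ => h γ • T γ := by
  refine Summable.of_norm_bounded ((X1_summ h).mul_right C) fun γ => ?_
  rw [norm_smul]
  exact mul_le_mul_of_nonneg_left (hT γ) (abs_nonneg _)

/-- The bounded operator with prescribed values on the standard basis. -/
def sumL {n : ℕ} {B : Type*} [NormedAddCommGroup B] [NormedSpace ℝ B] [CompleteSpace B]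
    (T : (Fin n → ℕ) → B) (C : ℝ) (hT : ∀ γ, ‖T γ‖ ≤ C) : X1 n →L[ℝ] B :=
  LinearMap.mkContinuous
    { toFun := fun h => ∑' γ, h γ • T γ
      map_add' := fun h k => by
        rw [← (sumL_summ T C hT h).tsum_add (sumL_summ T C hT k)]
        refine tsum_congr fun γ => ?_
        rw [← add_smul]; rfl
      map_smul' := fun c h => by
        rw [RingHom.id_apply, ← (sumL_summ T C hT h).tsum_const_smul]
        refine tsum_congr fun γ => ?_
        rw [smul_smul]; rfl } C (fun h => by
        change ‖∑' γ, h γ • T γ‖ ≤ _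
        rw [X1_norm, mul_comm, ← tsum_mul_right]
        refine tsum_of_norm_bounded ((X1_summ h).mul_right C).hasSum fun γ => ?_
        rw [norm_smul]
        exact mul_le_mul_of_nonneg_left (hT γ) (abs_nonneg _))

lemma sumL_apply {n : ℕ} {B : Type*} [NormedAddCommGroup B] [NormedSpace ℝ B] [CompleteSpace B]
    (T : (Fin n → ℕ) → B) (C : ℝ) (hT : ∀ γ, ‖T γ‖ ≤ C) (h : X1 n) :
    sumL T C hT h = ∑' γ, h γ • T γ := rfl

lemma sumL_norm {n : ℕ} {B : Type*} [NormedAddCommGroup B] [NormedSpace ℝ B] [CompleteSpace B]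
    (T : (Fin n → ℕ) → B) (C : ℝ) (hC : 0 ≤ C) (hT : ∀ γ, ‖T γ‖ ≤ C) : ‖sumL T C hT‖ ≤ C :=
  LinearMap.mkContinuous_norm_le _ hC _

/-- shift of a family. -/
def shf {n : ℕ} (κ : Fin n → ℕ) (v : (Fin n → ℕ) → ℝ) : (Fin n → ℕ) → ℝ := by
  classical exact fun β => if κ ≤ β then v (β - κ) else 0

lemma shf_add {n : ℕ} (κ : Fin n → ℕ) (v : (Fin n → ℕ) → ℝ) (β) : shf κ v (κ + β) = v β := by
  simp only [shf]
  rw [if_pos (by simp)]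
  congr 1
  simp

lemma shf_support {n : ℕ} (κ : Fin n → ℕ) (v : (Fin n → ℕ) → ℝ) :
    ∀ β, β ∉ Set.range (fun β : Fin n → ℕ => κ + β) → shf κ v β = 0 := by
  intro β hβ
  simp only [shf]
  rw [if_neg]
  intro h
  exact hβ ⟨β - κ, by simpa using add_tsub_cancel_of_le h⟩

lemma add_inj {n : ℕ} (κ : Fin n → ℕ) : Function.Injective (fun β : Fin n → ℕ => κ + β) :=
  fun _ _ h => add_left_cancel h

lemma tsum_shf {n : ℕ} (κ : Fin n → ℕ) (u : (Fin n → ℕ) → ℝ)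
    (hu : ∀ β, β ∉ Set.range (fun β : Fin n → ℕ => κ + β) → u β = 0) :
    ∑' β, u (κ + β) = ∑' β, u β :=
  (add_inj κ).tsum_eq (f := u) (fun β hβ => by
    by_contra h; exact hβ (hu β h))

lemma shf_summ {n : ℕ} (κ : Fin n → ℕ) (v : (Fin n → ℕ) → ℝ) (hv : Summable fun α => |v α|) :
    Summable fun α => |shf κ v α| := by
  refine ((add_inj κ).summable_iff (f := fun α => |shf κ v α|) ?_).1 ?_
  · intro β hβ
    simp [shf_support κ v β hβ]
  · refine hv.congr fun β => ?_
    simp [shf_add]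

/-- Division with remainder in the space of summable families. -/
lemma unit_division {n : ℕ} {ι : Type*} [Fintype ι] (e : ι → (Fin n → ℕ))
    (b : ι → (Fin n → ℕ) → ℝ) (hb : ∀ i, Summable fun α => |b i α|)
    (hbt : ∀ i, ∑' α, |b i α - Pi.single (M := fun _ => ℝ) (e i) 1 α| ≤ 1 / 2)
    (a : (Fin n → ℕ) → ℝ) (ha : Summable fun α => |a α|) :
    ∃ (c : ι → (Fin n → ℕ) → ℝ) (d : (Fin n → ℕ) → ℝ), (∀ i, Summable fun α => |c i α|) ∧
      (Summable fun α => |d α|) ∧ (∀ α, (∃ i, e i ≤ α) → d α = 0) ∧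
      ∀ Y : Fin n → ℝ, (∀ i, |Y i| ≤ 1) →
        ∑' α, a α * mon α Y = ∑ i, (∑' α, c i α * mon α Y) * (∑' α, b i α * mon α Y)
          + ∑' α, d α * mon α Y := by
  classical
  let I : (Fin n → ℕ) → Option ι := fun γ =>
    if h : ∃ i, e i ≤ γ then some h.choose else none
  have hI : ∀ γ i, I γ = some i → e i ≤ γ := by
    intro γ i h
    simp only [I] at h
    split_ifs at h with h'
    cases h
    exact h'.choose_spec
  have hI0 : ∀ γ, (∃ i, e i ≤ γ) → I γ ≠ none := by
    intro γ h
    simp [I, h]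
  let τ : ι → (Fin n → ℕ) → ℝ := fun i α => Pi.single (M := fun _ => ℝ) (e i) 1 α - b i α
  have hsing : ∀ i, Summable fun α => |Pi.single (M := fun _ => ℝ) (e i) 1 α| := by
    intro i
    refine summable_of_ne_finset_zero (s := {e i}) fun α hα => ?_
    rw [Pi.single_eq_of_ne (by simpa using hα), abs_zero]
  have hτ : ∀ i, Summable fun α => |τ i α| := fun i =>
    Summable.of_nonneg_of_le (fun _ => abs_nonneg _) (fun α => abs_sub _ _)
      ((hsing i).add (hb i))
  let Tg : (Fin n → ℕ) → X1 n := fun γ => match I γ with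
    | none => 0
    | some i => toX1 (shf (γ - e i) (τ i)) (shf_summ _ _ (hτ i))
  have hTg : ∀ γ, ‖Tg γ‖ ≤ 1 / 2 := by
    intro γ
    simp only [Tg]
    rcases hIγ : I γ with _ | i
    · simp
    · simp only []
      rw [X1_norm]
      simp only [toX1_apply]
      rw [← tsum_shf (γ - e i) (fun β => |shf (γ - e i) (τ i) β|)
        (fun β hβ => by simp [shf_support _ _ β hβ])]
      simp only [shf_add]
      refine le_trans (le_of_eq (tsum_congr fun α => ?_)) (hbt i)
      rw [abs_sub_comm]
  let T : X1 n →L[ℝ] X1 n := sumL Tg (1 / 2) hTg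
  have hT : ‖T‖ < 1 := (sumL_norm _ _ (by norm_num) _).trans_lt (by norm_num)
  let h : X1 n := ((Units.oneSub T hT)⁻¹ : (X1 n →L[ℝ] X1 n)ˣ).1 (toX1 a ha)
  have hh : toX1 a ha = h - T h := by
    have h1 : ((Units.oneSub T hT) * (Units.oneSub T hT)⁻¹ : (X1 n →L[ℝ] X1 n)ˣ).1 (toX1 a ha)
      = toX1 a ha := by rw [mul_inv_cancel]; rfl
    rw [← h1]
    rfl
  let c : ι → (Fin n → ℕ) → ℝ := fun i κ => if I (e i + κ) = some i then h (e i + κ) else 0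
  let d : (Fin n → ℕ) → ℝ := fun γ => if I γ = none then h γ else 0
  have hcs : ∀ i, Summable fun α => |c i α| := by
    intro i
    refine Summable.of_nonneg_of_le (fun _ => abs_nonneg _) (fun κ => ?_)
      ((X1_summ h).comp_injective (add_inj (e i)))
    simp only [c, comp]
    split_ifs
    · exact le_rfl
    · simp
  have hds : Summable fun α => |d α| := by
    refine Summable.of_nonneg_of_le (fun _ => abs_nonneg _) (fun κ => ?_) (X1_summ h)
    simp only [d]
    split_ifs
    · exact le_rfl
    · simp
  refine ⟨c, d, hcs, hds, fun α hα => by simp [d, hI0 α hα], fun Y hY => ?_⟩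
  have hmon : ∀ γ, ‖mon γ Y‖ ≤ 1 := fun γ => by
    have := mon_abs_le γ Y (fun _ => 1) hY
    rwa [mon_const, one_pow] at this
  let ev : X1 n →L[ℝ] ℝ := sumL (fun γ => mon γ Y) 1 hmon
  have hev : ∀ v, ev v = ∑' γ, v γ * mon γ Y := fun v => rfl
  have hsum : ∀ v : (Fin n → ℕ) → ℝ, (Summable fun α => |v α|) →
      Summable fun α => v α * mon α Y := fun v hv =>
    sumL_summ (fun γ => mon γ Y) 1 hmon (toX1 v hv)
  have hevT : ∀ γ i, I γ = some i → mon γ Y - ev (Tg γ) =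
      mon (γ - e i) Y * ∑' α, b i α * mon α Y := by
    intro γ i hi
    have h1 : ev (Tg γ) = mon (γ - e i) Y * ∑' α, τ i α * mon α Y := by
      rw [hev]
      simp only [Tg, hi]
      simp only [toX1_apply]
      rw [← tsum_shf (γ - e i) (fun β => shf (γ - e i) (τ i) β * mon β Y)
        (fun β hβ => by simp [shf_support _ _ β hβ]), ← tsum_mul_left]
      refine tsum_congr fun β => ?_
      rw [shf_add, mon_add]; ring
    have h2 : ∑' α, τ i α * mon α Y = mon (e i) Y - ∑' α, b i α * mon α Y := by
      have h3 : ∑' α, Pi.single (M := fun _ => ℝ) (e i) 1 α * mon α Y = mon (e i) Y := by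
        rw [tsum_eq_single (e i)]
        · simp
        · intro β hβ
          simp [Pi.single_eq_of_ne hβ]
      rw [← h3, ← (hsum _ (hsing i)).tsum_sub (hsum _ (hb i))]
      refine tsum_congr fun α => ?_
      simp only [τ]; ring
    have h4 : mon γ Y = mon (γ - e i) Y * mon (e i) Y := by
      rw [← mon_add, tsub_add_cancel_of_le (hI γ i hi)]
    rw [h1, h2, h4]; ring
  have hTn : ∀ γ, I γ = none → Tg γ = 0 := by
    intro γ hγ
    simp only [Tg, hγ]
  have hmain : ∑' α, a α * mon α Y = ∑' γ, h γ * (mon γ Y - ev (Tg γ)) := by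
    have h1 : ev (T h) = ∑' γ, h γ * ev (Tg γ) := by
      change ev (∑' γ, h γ • Tg γ) = _
      rw [ContinuousLinearMap.map_tsum _ (sumL_summ Tg _ hTg h)]
      simp
    have hs2 : Summable fun γ => h γ * ev (Tg γ) :=
      ((sumL_summ Tg _ hTg h).mapL ev).congr fun γ => by simp
    calc ∑' α, a α * mon α Y = ev (toX1 a ha) := rfl
      _ = ev h - ev (T h) := by rw [hh, map_sub]
      _ = _ := by
        rw [h1, hev, ← (hsum _ (X1_summ h)).tsum_sub hs2]
        exact tsum_congr fun γ => by ring
  rw [hmain]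
  have hterm : ∀ γ, h γ * (mon γ Y - ev (Tg γ)) =
      ∑ i, (if I γ = some i then h γ * mon (γ - e i) Y else 0) * (∑' α, b i α * mon α Y)
        + d γ * mon γ Y := by
    intro γ
    rcases hIγ : I γ with _ | i
    · simp [hTn γ hIγ, d, hIγ]
    · rw [hevT γ i hIγ]
      simp [d, hIγ, mul_assoc]
  have hci : ∀ i, (∀ γ, γ ∉ Set.range (fun β : Fin n → ℕ => e i + β) →
      (if I γ = some i then h γ * mon (γ - e i) Y else 0) = 0) := by
    intro i γ hγ
    rw [if_neg]
    intro hi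
    exact hγ ⟨γ - e i, by simpa using add_tsub_cancel_of_le (hI γ i hi)⟩
  have hcc : ∀ i κ, (if I (e i + κ) = some i then h (e i + κ) * mon (e i + κ - e i) Y else 0)
      = c i κ * mon κ Y := by
    intro i κ
    rw [add_tsub_cancel_left]
    simp only [c]
    split_ifs <;> simp
  have hci_t : ∀ i, ∑' γ, (if I γ = some i then h γ * mon (γ - e i) Y else 0) =
      ∑' κ, c i κ * mon κ Y := by
    intro i
    rw [← tsum_shf (e i) _ (hci i)]
    exact tsum_congr fun κ => hcc i κ
  have hci_s : ∀ i, Summable fun γ => (if I γ = some i then h γ * mon (γ - e i) Y else 0) := by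
    intro i
    refine ((add_inj (e i)).summable_iff (hci i)).1 ?_
    exact (hsum _ (hcs i)).congr fun κ => (hcc i κ).symm
  rw [tsum_congr hterm, Summable.tsum_add (summable_sum fun i _ => (hci_s i).mul_right _)
    (hsum _ hds), Summable.tsum_finsetSum fun i _ => (hci_s i).mul_right _]
  congr 1
  refine Finset.sum_congr rfl fun i _ => ?_
  rw [tsum_mul_right, hci_t]


/-- Multiplicative weight of an exponent: an injective map to `ℕ`. -/
def Lw {n : ℕ} (α : Fin n → ℕ) : ℕ := ∏ i : Fin n, (Nat.nth Nat.Prime i) ^ α i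

lemma pp {n : ℕ} (i : Fin n) : (Nat.nth Nat.Prime i).Prime := Nat.prime_nth_prime i

lemma Lw_pos {n : ℕ} (α : Fin n → ℕ) : 0 < Lw α :=
  Finset.prod_pos fun i _ => pow_pos (pp i).pos _

lemma Lw_inj {n : ℕ} : Function.Injective (Lw (n := n)) := by
  intro α β h
  ext j
  have key : ∀ α : Fin n → ℕ, (Lw α).factorization (Nat.nth Nat.Prime j) = α j := by
    intro α
    rw [Lw, Nat.factorization_prod fun i _ => pow_ne_zero _ (pp i).ne_zero]
    rw [Finset.sum_congr rfl fun i _ => (pp i).factorization_pow]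
    rw [Finsupp.finsetSum_apply, Finset.sum_eq_single j]
    · simp
    · intro i _ hij
      rw [Finsupp.single_eq_of_ne]
      intro h
      exact hij (Fin.ext (Nat.nth_injective Nat.infinite_setOfPred_prime h.symm))
    · simp
  rw [← key α, ← key β, h]

/-- Radii. -/
def rho {n : ℕ} (s : ℕ) (i : Fin n) : ℝ := ((Nat.nth Nat.Prime i : ℝ)⁻¹) ^ s

lemma rho_pos {n : ℕ} (s : ℕ) (i : Fin n) : 0 < rho s i := by
  have := (pp i).pos
  unfold rho
  positivity

lemma mon_rho {n : ℕ} (s : ℕ) (α : Fin n → ℕ) : mon α (rho s) = ((Lw α : ℝ)⁻¹) ^ s := by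
  simp only [mon, rho, Lw]
  push_cast
  rw [← Finset.prod_inv_distrib, ← Finset.prod_pow]
  refine Finset.prod_congr rfl fun i _ => ?_
  rw [← pow_mul, mul_comm, pow_mul, inv_pow]

lemma rho_tendsto {n : ℕ} (i : Fin n) : Tendsto (fun s => rho s i) atTop (𝓝 0) := by
  have h2 : (2 : ℝ) ≤ Nat.nth Nat.Prime i := by exact_mod_cast (pp i).two_le
  refine tendsto_pow_atTop_nhds_zero_of_lt_one (by positivity) ?_
  exact inv_lt_one_of_one_lt₀ (by linarith)

lemma mon_mono {n : ℕ} (α : Fin n → ℕ) (x y : Fin n → ℝ) (hx : ∀ i, 0 ≤ x i)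
    (h : ∀ i, x i ≤ y i) : mon α x ≤ mon α y :=
  (le_abs_self _).trans (mon_abs_le α x y fun i => by rw [abs_of_nonneg (hx i)]; exact h i)

lemma Rep.eventually_rho {n : ℕ} {f : Eu n → ℝ} {a : (Fin n → ℕ) → ℝ} {r : ℝ} (h : Rep f a r) :
    ∀ᶠ s in atTop, (∀ i, rho (n := n) s i ≤ r) ∧ Summable fun α => |a α| * mon α (rho s) := by
  have h1 : ∀ᶠ s in atTop, ∀ i, rho (n := n) s i ≤ r := by
    rw [eventually_all]
    exact fun i => (rho_tendsto i).eventually (ge_mem_nhds h.pos)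
  filter_upwards [h1] with s hs
  refine ⟨hs, Summable.of_nonneg_of_le (fun α => mul_nonneg (abs_nonneg _)
    (mon_nonneg _ _ fun i => (rho_pos s i).le)) (fun α => ?_) h.summ⟩
  exact mul_le_mul_of_nonneg_left (mon_mono _ _ _ (fun i => (rho_pos s i).le) hs) (abs_nonneg _)

/-- `γ` is the leading exponent of the monic series `b`. -/
def Lead {n : ℕ} (b : (Fin n → ℕ) → ℝ) (γ : Fin n → ℕ) : Prop :=
  b γ = 1 ∧ ∀ β, β ≠ γ → b β ≠ 0 → Lw γ < Lw β

lemma Lead.eventually {n : ℕ} {f : Eu n → ℝ} {b : (Fin n → ℕ) → ℝ} {r : ℝ} (h : Rep f b r)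
    {γ : Fin n → ℕ} (hl : Lead b γ) :
    ∀ᶠ s in atTop, ∑' α, |b α * mon α (rho s) / mon γ (rho s) -
      Pi.single (M := fun _ => ℝ) γ 1 α| ≤ 1 / 2 := by
  obtain ⟨s0, hs0⟩ := h.eventually_rho.exists
  have hpos : ∀ s, 0 < mon γ (rho s) := fun s => mon_pos _ _ (rho_pos s)
  have hterm : ∀ s α, |b α * mon α (rho s) / mon γ (rho s) - Pi.single (M := fun _ => ℝ) γ 1 α| =
      if α = γ then 0 else |b α| * ((Lw γ : ℝ) / Lw α) ^ s := by
    intro s α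
    split_ifs with hα
    · subst hα
      rw [hl.1, Pi.single_eq_same, one_mul, div_self (hpos s).ne', sub_self, abs_zero]
    · rw [Pi.single_eq_of_ne hα, sub_zero, abs_div, abs_mul, abs_of_pos (hpos s),
        abs_of_pos (mon_pos _ _ (rho_pos s)), mon_rho, mon_rho, mul_div_assoc, ← div_pow]
      congr 2
      rw [inv_div_inv]
  have hlim : Tendsto (fun s => ∑' α, |b α * mon α (rho s) / mon γ (rho s) -
      Pi.single (M := fun _ => ℝ) γ 1 α|) atTop (𝓝 (∑' α : Fin n → ℕ, (0 : ℝ))) := by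
    refine tendsto_tsum_of_dominated_convergence
      (bound := fun α => |b α| * mon α (rho s0) / mon γ (rho s0)) (hs0.2.div_const _) ?_ ?_
    · intro α
      simp only [hterm]
      split_ifs with hα
      · exact tendsto_const_nhds
      · by_cases hb : b α = 0
        · simp [hb]
        · have h1 : (Lw γ : ℝ) / Lw α < 1 := by
            rw [div_lt_one (by exact_mod_cast Lw_pos α)]
            exact_mod_cast hl.2 α hα hb
          have := (tendsto_pow_atTop_nhds_zero_of_lt_one (by positivity) h1).const_mul |b α|
          rwa [mul_zero] at this
    · filter_upwards [eventually_ge_atTop s0] with s hs α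
      rw [hterm, Real.norm_eq_abs]
      split_ifs with hα
      · rw [abs_zero]
        have := mon_pos α _ (rho_pos (n := n) s0)
        have := hpos s0
        positivity
      · rw [abs_of_nonneg (by positivity), mul_div_assoc, mon_rho, mon_rho, ← div_pow,
          inv_div_inv]
        by_cases hb : b α = 0
        · simp [hb]
        · have h1 : (Lw γ : ℝ) / Lw α ≤ 1 := by
            rw [div_le_one (by exact_mod_cast Lw_pos α)]
            exact_mod_cast (hl.2 α hα hb).le
          exact mul_le_mul_of_nonneg_left (pow_le_pow_of_le_one (by positivity) h1 hs)
            (abs_nonneg _)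
  rw [tsum_zero] at hlim
  exact hlim.eventually (ge_mem_nhds (by norm_num))

lemma exists_small {n : ℕ} (ρ : Fin n → ℝ) (h : ∀ i, 0 < ρ i) : ∃ r, 0 < r ∧ ∀ i, r ≤ ρ i := by
  have h1 : ∀ᶠ r : ℝ in 𝓝[>] 0, ∀ i, r ≤ ρ i := by
    rw [eventually_all]
    exact fun i => nhdsWithin_le_nhds (ge_mem_nhds (h i))
  obtain ⟨r, h1, h2⟩ := (h1.and eventually_mem_nhdsWithin).exists
  exact ⟨r, h2, h1⟩

lemma rep_weight {n : ℕ} (d : (Fin n → ℕ) → ℝ) (hd : Summable fun α => |d α|) (ρ : Fin n → ℝ)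
    (hρ : ∀ i, 0 < ρ i) (r : ℝ) (hr : 0 < r) (hrρ : ∀ i, r ≤ ρ i) :
    Rep (fun x => ∑' α, d α / mon α ρ * mon α x.ofLp) (fun α => d α / mon α ρ) r := by
  refine ⟨hr, ?_, fun x _ => rfl⟩
  refine Summable.of_nonneg_of_le (fun α => mul_nonneg (abs_nonneg _)
    (mon_nonneg _ _ fun _ => hr.le)) (fun α => ?_) hd
  have h1 := mon_pos α ρ hρ
  rw [abs_div, abs_of_pos h1, div_mul_eq_mul_div, div_le_iff₀ h1]
  exact mul_le_mul_of_nonneg_left (mon_mono _ _ _ (fun _ => hr.le) hrρ) (abs_nonneg _)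

lemma division {n : ℕ} {ι : Type*} [Fintype ι] (e : ι → (Fin n → ℕ)) (f : ι → Eu n → ℝ)
    (b : ι → (Fin n → ℕ) → ℝ) (r : ι → ℝ) (hf : ∀ i, Rep (f i) (b i) (r i))
    (hl : ∀ i, Lead (b i) (e i)) {g : Eu n → ℝ} (hg : AnalyticAt ℝ g 0) :
    ∃ (q : ι → Eu n → ℝ) (u : Eu n → ℝ) (d : (Fin n → ℕ) → ℝ) (r' : ℝ),
      (∀ i, AnalyticAt ℝ (q i) 0) ∧ Rep u d r' ∧ (∀ α, (∃ i, e i ≤ α) → d α = 0) ∧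
      ∀ᶠ x in 𝓝 0, g x = ∑ i, q i x * f i x + u x := by
  obtain ⟨a, r0, hg⟩ := exists_rep hg
  have h1 := eventually_all.2 fun i => (hf i).eventually_rho
  have h2 := eventually_all.2 fun i => (hl i).eventually (hf i)
  obtain ⟨s, ⟨h0, h1⟩, h2⟩ := ((hg.eventually_rho.and h1).and h2).exists
  have hmp : ∀ α : Fin n → ℕ, 0 < mon α (rho s) := fun α => mon_pos _ _ (rho_pos s)
  obtain ⟨c, d, hc, hd, hd0, hY⟩ := unit_division e
    (fun i α => b i α * mon α (rho s) / mon (e i) (rho s)) (fun i => by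
      refine ((h1 i).2.div_const (mon (e i) (rho s))).congr fun α => ?_
      rw [abs_div, abs_mul, abs_of_pos (hmp _), abs_of_pos (hmp _)]) h2
    (fun α => a α * mon α (rho s)) (by
      refine h0.2.congr fun α => ?_
      rw [abs_mul, abs_of_pos (hmp _)])
  obtain ⟨r', hr', hr'ρ⟩ := exists_small (rho (n := n) s) (rho_pos s)
  refine ⟨fun i x => (mon (e i) (rho s))⁻¹ * ∑' α, c i α / mon α (rho s) * mon α x.ofLp,
    fun x => ∑' α, d α / mon α (rho s) * mon α x.ofLp, _, r',
    fun i => analyticAt_const.mul (rep_weight (c i) (hc i) _ (rho_pos s) r' hr' hr'ρ).analyticAt,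
    rep_weight d hd _ (rho_pos s) r' hr' hr'ρ, ?_, ?_⟩
  · intro α hα
    rw [hd0 α hα, zero_div]
  · have hnear : ∀ᶠ x : Eu n in 𝓝 0, ∀ i, |x i| ≤ rho s i := by
      rw [eventually_all]
      intro i
      have : Tendsto (fun x : Eu n => |x i|) (𝓝 0) (𝓝 |(0 : Eu n) i|) :=
        (Continuous.abs (EuclideanSpace.proj (𝕜 := ℝ) i).continuous).tendsto _
      rw [PiLp.zero_apply, abs_zero] at this
      exact this.eventually (ge_mem_nhds (rho_pos s i))
    filter_upwards [hnear] with x hx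
    have hdiv : ∀ α : Fin n → ℕ,
        mon α (fun i => x i / rho s i) = mon α x.ofLp / mon α (rho s) := by
      intro α
      rw [eq_div_iff (hmp α).ne', ← mon_mul]
      congr 1
      ext i
      exact div_mul_cancel₀ _ (rho_pos s i).ne'
    have h3 := hY (fun i => x i / rho s i) (fun i => by
      rw [abs_div, abs_of_pos (rho_pos s i), div_le_one (rho_pos s i)]
      exact hx i)
    simp only [hdiv] at h3
    rw [hg.eq x fun i => (hx i).trans (h0.1 i)]
    have e1 : ∀ v : (Fin n → ℕ) → ℝ, ∑' α, v α * mon α (rho s) * (mon α x.ofLp / mon α (rho s))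
        = ∑' α, v α * mon α x.ofLp := fun v => tsum_congr fun α => by
      field_simp [(hmp α).ne']
    have e2 : ∀ v : (Fin n → ℕ) → ℝ, ∑' α, v α * (mon α x.ofLp / mon α (rho s))
        = ∑' α, v α / mon α (rho s) * mon α x.ofLp := fun v => tsum_congr fun α => by
      ring
    rw [e1, e2] at h3
    rw [h3]
    congr 1
    refine Finset.sum_congr rfl fun i _ => ?_
    rw [e2, (hf i).eq x fun j => (hx j).trans ((h1 i).1 j)]
    have e3 : ∑' α, b i α * mon α (rho s) / mon (e i) (rho s) * (mon α x.ofLp / mon α (rho s))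
        = (mon (e i) (rho s))⁻¹ * ∑' α, b i α * mon α x.ofLp := by
      rw [← tsum_mul_left]
      refine tsum_congr fun α => ?_
      have := (hmp α).ne'
      field_simp
    rw [e3]; ring


/-- Functions analytic at the origin. -/
def A0 (n : ℕ) : Subring (Eu n → ℝ) where
  carrier := {f | AnalyticAt ℝ f 0}
  mul_mem' := fun ha hb => AnalyticAt.mul ha hb
  one_mem' := analyticAt_const
  add_mem' := fun ha hb => AnalyticAt.add ha hb
  zero_mem' := analyticAt_const
  neg_mem' := fun ha => AnalyticAt.neg ha

/-- Functions vanishing near the origin. -/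
def Z0 (n : ℕ) : Ideal (A0 n) where
  carrier := {f | ∀ᶠ x in 𝓝 0, f.1 x = 0}
  add_mem' := fun {a b} ha hb => by
    filter_upwards [ha, hb] with x h1 h2
    simp [h1, h2]
  zero_mem' := by simp
  smul_mem' := fun c {a} ha => by
    filter_upwards [ha] with x h1
    simp [h1]

/-- The ring of germs of analytic functions at the origin. -/
abbrev AG (n : ℕ) := A0 n ⧸ Z0 n

lemma mem_A0 {n : ℕ} {f : Eu n → ℝ} : f ∈ A0 n ↔ AnalyticAt ℝ f 0 := Iff.rfl

/-- The projection. -/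
def pr (n : ℕ) : A0 n →+* AG n := Ideal.Quotient.mk (Z0 n)

lemma pr_surj (n : ℕ) : Function.Surjective (pr n) := Ideal.Quotient.mk_surjective

lemma pr_eq {n : ℕ} {f g : A0 n} : pr n f = pr n g ↔ ∀ᶠ x in 𝓝 0, f.1 x = g.1 x := by
  rw [pr, Ideal.Quotient.eq]
  change (∀ᶠ x in 𝓝 0, (f - g).1 x = 0) ↔ _
  refine eventually_congr (Eventually.of_forall fun x => ?_)
  change f.1 x - g.1 x = 0 ↔ _
  exact sub_eq_zero

lemma A0_sum_apply {n : ℕ} {ι : Type*} (s : Finset ι) (f : ι → A0 n) (x : Eu n) :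
    (∑ i ∈ s, f i).1 x = ∑ i ∈ s, (f i).1 x := by
  have : ((∑ i ∈ s, f i : A0 n) : Eu n → ℝ) = ∑ i ∈ s, ((f i : A0 n) : Eu n → ℝ) := by
    push_cast; rfl
  rw [this, Finset.sum_apply]

lemma rep_smul {n : ℕ} {u : Eu n → ℝ} {d : (Fin n → ℕ) → ℝ} {r : ℝ} (h : Rep u d r) (c : ℝ) :
    Rep (fun x => c * u x) (fun α => c * d α) r := by
  refine ⟨h.pos, ?_, fun x hx => ?_⟩
  · refine (h.summ.mul_left |c|).congr fun α => ?_
    rw [abs_mul, mul_assoc]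
  · rw [h.eq x hx, ← tsum_mul_left]
    exact tsum_congr fun α => by ring

lemma Rep.eventually_eq {n : ℕ} {u : Eu n → ℝ} {d : (Fin n → ℕ) → ℝ} {r : ℝ} (h : Rep u d r) :
    ∀ᶠ x in 𝓝 0, u x = ∑' α, d α * mon α x.ofLp := by
  filter_upwards [Metric.ball_mem_nhds 0 h.pos] with x hx
  refine h.eq x fun i => (PiLp.norm_apply_le x i).trans ?_
  simpa using (mem_ball_zero_iff.1 hx).le

instance AG_noeth (n : ℕ) : IsNoetherianRing (AG n) := by
  classical
  rw [isNoetherianRing_iff_ideal_fg]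
  intro I
  let S : Set (Fin n → ℕ) := {γ | ∃ (f : A0 n) (b : (Fin n → ℕ) → ℝ) (r : ℝ),
    pr n f ∈ I ∧ Rep f.1 b r ∧ Lead b γ}
  have hS : S.IsPWO := by
    have := Set.IsPWO.pi (ι := Fin n) (α := fun _ => ℕ) (s := fun _ => Set.univ)
      (fun i => Set.IsWF.isPWO (Set.isWF_univ_iff.2 inferInstance))
    exact this.mono (by simp)
  let S0 : Set (Fin n → ℕ) := {γ | Minimal (· ∈ S) γ}
  have hS0 : S0.Finite := by
    refine IsAntichain.finite_of_partiallyWellOrderedOn (r := (· ≤ ·)) ?_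
      (Set.PartiallyWellOrderedOn.mono hS fun γ hγ => hγ.1)
    exact setOfPred_minimal_antichain _
  have hmin : ∀ γ ∈ S, ∃ e ∈ S0, e ≤ γ := by
    intro γ hγ
    obtain ⟨e, he, hm⟩ := exists_minimal_le_of_wellFoundedLT (· ∈ S) γ hγ
    exact ⟨e, hm, he⟩
  have hch : ∀ e : S0, ∃ (f : A0 n) (b : (Fin n → ℕ) → ℝ) (r : ℝ),
    pr n f ∈ I ∧ Rep f.1 b r ∧ Lead b e := fun e => e.2.1
  choose f b r hfI hrep hlead using hch
  have : Fintype S0 := hS0.fintype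
  refine ⟨Finset.univ.image fun e => pr n (f e), le_antisymm ?_ ?_⟩
  · rw [Ideal.span_le]
    intro x hx
    simp only [Finset.coe_image, Finset.coe_univ, Set.image_univ, Set.mem_range] at hx
    obtain ⟨e, rfl⟩ := hx
    exact hfI e
  · intro g hg
    obtain ⟨g, rfl⟩ := pr_surj n g
    obtain ⟨q, u, d, r', hq, hu, hd, heq⟩ := division (fun e : S0 => e.1) (fun e => (f e).1) b r
      hrep hlead (mem_A0.1 g.2)
    let Q : S0 → A0 n := fun e => ⟨q e, hq e⟩
    let u' : A0 n := ⟨u, hu.analyticAt⟩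
    have h1 : pr n g = ∑ e, pr n (Q e) * pr n (f e) + pr n u' := by
      simp only [← map_mul, ← map_sum, ← map_add]
      rw [pr_eq]
      filter_upwards [heq] with x hx
      rw [hx]
      change _ = (∑ e, Q e * f e).1 x + u x
      rw [A0_sum_apply]
      rfl
    have h2 : ∑ e, pr n (Q e) * pr n (f e) ∈ Ideal.span
        (((Finset.univ.image fun e => pr n (f e)) : Finset (AG n)) : Set (AG n)) := by
      refine Ideal.sum_mem _ fun e _ => Ideal.mul_mem_left _ _ (Ideal.subset_span ?_)
      simp
    have h2' : ∑ e, pr n (Q e) * pr n (f e) ∈ I :=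
      Ideal.sum_mem _ fun e _ => Ideal.mul_mem_left _ _ (hfI e)
    have h3 : pr n u' ∈ I := by
      have : pr n u' = pr n g - ∑ e, pr n (Q e) * pr n (f e) := by rw [h1]; ring
      rw [this]
      exact Ideal.sub_mem _ hg h2'
    have h4 : ∀ α, d α = 0 := by
      by_contra hne
      push Not at hne
      obtain ⟨α, hα, hαmin⟩ := WellFounded.has_min
        (InvImage.wf (Lw (n := n)) Nat.lt_wfRel.wf) {α | d α ≠ 0} hne
      have hα' : d α ≠ 0 := hα
      have : α ∈ S := by
        refine ⟨⟨fun _ => (d α)⁻¹, analyticAt_const⟩ * u', _, r', ?_, rep_smul hu (d α)⁻¹, ?_⟩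
        · rw [map_mul]; exact Ideal.mul_mem_left _ _ h3
        · refine ⟨inv_mul_cancel₀ hα', fun β hβ hdβ => ?_⟩
          have h5 : d β ≠ 0 := fun h => hdβ (by simp [h])
          have h6 : ¬ Lw β < Lw α := hαmin β h5
          exact lt_of_le_of_ne (not_lt.1 h6) fun h => hβ (Lw_inj h.symm)
      obtain ⟨e, he, hle⟩ := hmin α this
      exact hα' (hd α ⟨⟨e, he⟩, hle⟩)
    have h5 : pr n u' = 0 := by
      rw [← map_zero (pr n), pr_eq]
      filter_upwards [hu.eventually_eq] with x hx
      change u x = 0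
      rw [hx]
      simp [h4]
    rw [h1, h5, add_zero]
    exact h2

/-- coordinate functions. -/
def crd {n : ℕ} (i : Fin n) : A0 n :=
  ⟨fun x => x i, (EuclideanSpace.proj (𝕜 := ℝ) i : Eu n →L[ℝ] ℝ).analyticAt 0⟩

lemma rep_crd {n : ℕ} (i : Fin n) :
    Rep (crd i).1 (Pi.single (M := fun _ => ℝ) (Pi.single i 1) 1) 1 := by
  refine ⟨one_pos, ?_, fun x _ => ?_⟩
  · refine summable_of_ne_finset_zero (s := {Pi.single i 1}) fun α hα => ?_
    rw [Pi.single_eq_of_ne (by simpa using hα), abs_zero, zero_mul]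
  · rw [tsum_eq_single (Pi.single i 1)]
    · rw [Pi.single_eq_same, one_mul, mon, Finset.prod_eq_single i]
      · simp [crd]
      · intro j _ hj
        rw [Pi.single_eq_of_ne hj, pow_zero]
      · simp
    · intro β hβ
      rw [Pi.single_eq_of_ne hβ, zero_mul]

lemma hadamard {n : ℕ} (g : A0 n) (hg : g.1 0 = 0) :
    pr n g ∈ Ideal.span (Set.range fun i : Fin n => pr n (crd i)) := by
  obtain ⟨q, u, d, r', hq, hu, hd, heq⟩ := division (fun i : Fin n => Pi.single i 1)
    (fun i => (crd i).1) _ _ rep_crd (fun i => ⟨Pi.single_eq_same _ _, fun β hβ h =>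
      absurd (Pi.single_eq_of_ne hβ _) h⟩) (mem_A0.1 g.2)
  have hd' : ∀ α, α ≠ 0 → d α = 0 := by
    intro α hα
    obtain ⟨i, hi⟩ := Function.ne_iff.1 hα
    refine hd α ⟨i, fun j => ?_⟩
    by_cases hj : j = i
    · subst hj
      rw [Pi.single_eq_same]
      exact Nat.one_le_iff_ne_zero.2 hi
    · rw [Pi.single_eq_of_ne hj]
      exact Nat.zero_le _
  have hu' : ∀ᶠ x in 𝓝 0, u x = d 0 := by
    filter_upwards [hu.eventually_eq] with x hx
    rw [hx, tsum_eq_single 0 fun α hα => by rw [hd' α hα, zero_mul]]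
    simp [mon]
  have h0 : d 0 = 0 := by
    have h1 := heq.self_of_nhds
    rw [hg, hu'.self_of_nhds] at h1
    simpa [crd] using h1.symm
  let Q : Fin n → A0 n := fun e => ⟨q e, hq e⟩
  have h1 : pr n g = ∑ e, pr n (Q e) * pr n (crd e) := by
    simp only [← map_mul, ← map_sum]
    rw [pr_eq]
    filter_upwards [heq, hu'] with x hx hx'
    rw [hx, hx', h0, A0_sum_apply, add_zero]
    rfl
  rw [h1]
  exact Ideal.sum_mem _ fun e _ => Ideal.mul_mem_left _ _ (Ideal.subset_span ⟨e, rfl⟩)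

/-- ideals of germs from ideals of functions -/
lemma mem_map_pr {n : ℕ} (J : Ideal (A0 n)) (hJ : Z0 n ≤ J) (f : A0 n) :
    pr n f ∈ J.map (pr n) ↔ f ∈ J := by
  refine ⟨fun h => ?_, fun h => Ideal.mem_map_of_mem _ h⟩
  obtain ⟨g, hg, h⟩ := (Ideal.mem_map_iff_of_surjective _ (pr_surj n)).1 h
  have : f - g ∈ Z0 n := Ideal.Quotient.eq.1 h.symm
  have := J.add_mem (hJ this) hg
  simpa using this

lemma map_pr_prime {n : ℕ} (J : Ideal (A0 n)) [J.IsPrime] (hJ : Z0 n ≤ J) :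
    (J.map (pr n)).IsPrime :=
  Ideal.map_isPrime_of_surjective (pr_surj n) (by
    intro x hx
    refine hJ ?_
    have : pr n x = pr n 0 := by rw [map_zero]; exact hx
    have := Ideal.Quotient.eq.1 this
    simpa using this)

/-- The height bound: there is no strict chain of `n + 2` primes below the maximal ideal. -/
lemma no_chain {n : ℕ} (J : ℕ → Ideal (A0 n)) (hJ : ∀ k ≤ n, (J k).IsPrime)
    (hZ : ∀ k ≤ n, Z0 n ≤ J k) (hlt : ∀ k < n, J k < J (k + 1))
    (h0 : ∀ f ∈ J n, f.1 0 = 0) (h1 : ∃ f : A0 n, f.1 0 = 0 ∧ f ∉ J n) : False := by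
  let ev : A0 n →+* ℝ := (Pi.evalRingHom (fun _ : Eu n => ℝ) 0).comp (A0 n).subtype
  let m : Ideal (A0 n) := RingHom.ker ev
  have hm : m.IsPrime := RingHom.ker_isPrime ev
  have hmem : ∀ f : A0 n, f ∈ m ↔ f.1 0 = 0 := fun f => Iff.rfl
  have hZm : Z0 n ≤ m := fun f hf => 
    (hmem f).2 (Filter.Eventually.self_of_nhds (p := fun x => f.1 x = 0) hf)
  have hlt' : ∀ K L : Ideal (A0 n), Z0 n ≤ K → Z0 n ≤ L → K < L →
      K.map (pr n) < L.map (pr n) := by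
    intro K L hK hL h
    refine lt_of_le_not_ge (Ideal.map_mono h.le) fun h' => h.not_ge fun f hf => ?_
    exact (mem_map_pr K hK f).1 (h' ((mem_map_pr L hL f).2 hf))
  have hh : ∀ k ≤ n, (k : ℕ∞) ≤ ((J k).map (pr n)).height := by
    intro k
    induction k with
    | zero => intro _; simp
    | succ k ih =>
      intro hk
      have := hJ k (by omega)
      have := hJ (k + 1) hk
      have := map_pr_prime (J k) (hZ k (by omega))
      have := map_pr_prime (J (k + 1)) (hZ (k + 1) hk)
      have h2 := Ideal.height_add_one_le_of_lt_of_isPrime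
        (hlt' _ _ (hZ k (by omega)) (hZ (k + 1) hk) (hlt k (by omega)))
      refine le_trans ?_ h2
      push_cast
      gcongr
      exact ih (by omega)
  have hJm : J n < m := by
    obtain ⟨f, hf, hf'⟩ := h1
    exact lt_of_le_not_ge (fun g hg => h0 g hg) fun h => hf' (h hf)
  have := hJ n le_rfl
  have := map_pr_prime (J n) (hZ n le_rfl)
  have hmp := map_pr_prime m hZm
  have h2 := Ideal.height_add_one_le_of_lt_of_isPrime (hlt' _ _ (hZ n le_rfl) hZm hJm)
  have h3 : m.map (pr n) = Ideal.span (Set.range fun i : Fin n => pr n (crd i)) := by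
    refine le_antisymm ?_ ?_
    · rw [Ideal.map_le_iff_le_comap]
      exact fun g hg => hadamard g hg
    · rw [Ideal.span_le]
      rintro _ ⟨i, rfl⟩
      exact Ideal.mem_map_of_mem _ ((hmem _).2 (by simp [crd]))
  have h4 : (m.map (pr n)).height ≤ ((Set.range fun i : Fin n => pr n (crd i)).ncard : ℕ∞) := by
    refine Ideal.height_le_card_of_mem_minimalPrimes_span (Set.finite_range _) ?_
    rw [← h3]
    simp [Ideal.minimalPrimes_eq_subsingleton_self]
  have h5 : (Set.range fun i : Fin n => pr n (crd i)).ncard ≤ n := by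
    rw [← Set.image_univ]
    refine (Set.ncard_image_le Set.finite_univ).trans ?_
    simp [Set.ncard_univ]
  have h6 : ((n : ℕ∞) + 1) ≤ n :=
    calc ((n : ℕ∞) + 1) ≤ ((J n).map (pr n)).height + 1 := by gcongr; exact hh n le_rfl
      _ ≤ _ := h2
      _ ≤ _ := h4
      _ ≤ n := by exact_mod_cast h5
  have h7 : n + 1 ≤ n := by exact_mod_cast h6
  omega


/-- Germs of analytic functions form a domain. -/
lemma germ_domain {n : ℕ} {p q : Eu n → ℝ} (hp : AnalyticAt ℝ p 0) (hq : AnalyticAt ℝ q 0)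
    (h : ∀ᶠ w in 𝓝 0, p w * q w = 0) :
    (∀ᶠ w in 𝓝 0, p w = 0) ∨ (∀ᶠ w in 𝓝 0, q w = 0) := by
  by_cases hp0 : ∀ᶠ w in 𝓝 0, p w = 0
  · exact Or.inl hp0
  right
  obtain ⟨r, hr, hball⟩ := Metric.eventually_nhds_iff_ball.1
    (h.and (hp.eventually_analyticAt.and hq.eventually_analyticAt))
  have hp1 : ∃ᶠ w in 𝓝 0, p w ≠ 0 := not_eventually.1 hp0
  obtain ⟨w, hw, hwr⟩ := (hp1.and_eventually (Metric.ball_mem_nhds (0 : Eu n) hr)).exists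
  have hqw : q =ᶠ[𝓝 w] 0 := by
    filter_upwards [(hball w hwr).2.1.continuousAt.eventually_ne hw,
      Metric.isOpen_ball.mem_nhds hwr] with z hz hzr
    exact (mul_eq_zero.1 (hball z hzr).1).resolve_left hz
  have hqa : AnalyticOnNhd ℝ q (ball 0 r) := fun z hz => (hball z hz).2.2
  have := hqa.eqOn_zero_of_preconnected_of_eventuallyEq_zero
    (convex_ball (0 : Eu n) r).isPreconnected hwr hqw
  filter_upwards [Metric.ball_mem_nhds (0 : Eu n) hr] with z hz using this hz

/-- Partial derivatives. -/
def D {n : ℕ} (i : Fin n) (f : A0 n) : A0 n :=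
  ⟨fun x => fderiv ℝ f.1 x (EuclideanSpace.single i 1), by
    rw [mem_A0]
    have h : AnalyticAt ℝ f.1 0 := f.2
    exact ((ContinuousLinearMap.apply ℝ ℝ (EuclideanSpace.single i (1 : ℝ))).analyticAt _).comp h.fderiv⟩

lemma D_apply {n : ℕ} (i : Fin n) (f : A0 n) (x : Eu n) :
    (D i f).1 x = fderiv ℝ f.1 x (EuclideanSpace.single i 1) := rfl

/-- `v = ∑ v i • e i`. -/
lemma eu_sum {n : ℕ} (v : Eu n) : v = ∑ i, v i • EuclideanSpace.single i (1 : ℝ) := by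
  ext j
  simp [Pi.single_apply]

lemma clm_eu {n : ℕ} {E : Type*} [NormedAddCommGroup E] [NormedSpace ℝ E] (T : Eu n →L[ℝ] E)
    (v : Eu n) : T v = ∑ i, v i • T (EuclideanSpace.single i (1 : ℝ)) := by
  conv_lhs => rw [eu_sum v]
  simp [map_sum]

/-- Analytic inverse function theorem, local form. -/
lemma local_inv {n : ℕ} {f : Fin n → Eu n → ℝ} {x : Eu n} (hf : ∀ i, AnalyticAt ℝ (f i) x)
    (h0 : ∀ i, f i x = 0)
    (hdet : (Matrix.of fun i j => fderiv ℝ (f i) x (EuclideanSpace.single j 1)).det ≠ 0) :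
    ∃ ψ : Eu n → Eu n, AnalyticAt ℝ ψ 0 ∧ ψ 0 = x ∧ ∀ᶠ w in 𝓝 0, ∀ i, f i (ψ w) = w i := by
  let φ : Eu n → Eu n := fun z => WithLp.toLp 2 (fun i => f i z)
  have hφ : AnalyticAt ℝ φ x := by
    have : AnalyticAt ℝ (fun z i => f i z) x := AnalyticAt.pi hf
    exact ((PiLp.continuousLinearEquiv 2 ℝ (fun _ : Fin n => ℝ)).symm.toContinuousLinearMap.analyticAt
      _).comp this
  have hd : ∀ v i, fderiv ℝ φ x v i = fderiv ℝ (f i) x v := by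
    intro v i
    have h1 := hφ.differentiableAt.hasFDerivAt
    have h2 := (EuclideanSpace.proj (𝕜 := ℝ) i).hasFDerivAt.comp x h1
    have h3 : fderiv ℝ (f i) x = (EuclideanSpace.proj (𝕜 := ℝ) i).comp (fderiv ℝ φ x) := h2.fderiv
    rw [h3]; rfl
  have hinj : Function.Injective (fderiv ℝ φ x) := by
    rw [injective_iff_map_eq_zero]
    intro v hv
    have : (Matrix.of fun i j => fderiv ℝ (f i) x (EuclideanSpace.single j 1)).mulVec v.ofLp = 0 := by
      funext i
      have h1 := hd v i
      rw [hv, clm_eu] at h1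
      simp only [Matrix.mulVec, dotProduct, Matrix.of_apply, Pi.zero_apply]
      rw [PiLp.zero_apply] at h1
      rw [h1]
      exact Finset.sum_congr rfl fun j _ => by simp [mul_comm]
    have := Matrix.eq_zero_of_mulVec_eq_zero hdet this
    ext j
    exact congrFun this j
  let e : Eu n ≃L[ℝ] Eu n :=
    (LinearEquiv.ofInjectiveEndo (fderiv ℝ φ x : Eu n →ₗ[ℝ] Eu n) hinj).toContinuousLinearEquiv
  have he : fderiv ℝ φ x = (e : Eu n →L[ℝ] Eu n) := by
    ext v; rfl
  have hs : HasStrictFDerivAt φ (e : Eu n →L[ℝ] Eu n) x := by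
    rw [← he]; exact hφ.hasStrictFDerivAt
  let P := hs.toOpenPartialHomeomorph φ
  have hφx : φ x = 0 := by
    ext i; exact h0 i
  have hxs : x ∈ P.source := hs.mem_toOpenPartialHomeomorph_source
  have ht : (0 : Eu n) ∈ P.target := by
    have := P.map_source hxs
    rwa [show P x = φ x from rfl, hφx] at this
  have hsx : P.symm 0 = x := by
    have := P.left_inv hxs
    rwa [show P x = φ x from rfl, hφx] at this
  refine ⟨P.symm, ?_, hsx, ?_⟩
  · refine OpenPartialHomeomorph.analyticAt_symm P (i := e) ht ?_ ?_
    · rw [hsx]; exact hφ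
    · rw [hsx]; exact he
  · filter_upwards [P.open_target.mem_nhds ht] with w hw i
    have : φ (P.symm w) = w := P.right_inv hw
    exact congrArg (fun z : Eu n => z i) this

/-- Kill the first `k` coordinates. -/
def kil {n : ℕ} (k : ℕ) : Eu n →L[ℝ] Eu n :=
  LinearMap.toContinuousLinearMap
    { toFun := fun w => WithLp.toLp 2 (fun i => if i.1 < k then 0 else w i)
      map_add' := fun a b => by ext i; simp; split_ifs <;> simp
      map_smul' := fun c b => by ext i; simp }

lemma kil_apply {n : ℕ} (k : ℕ) (w : Eu n) (i : Fin n) :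
    kil k w i = if i.1 < k then 0 else w i := rfl

lemma kil_kil {n : ℕ} (k : ℕ) (w : Eu n) : kil k (kil (k + 1) w) = kil (k + 1) w := by
  ext i
  simp only [kil_apply]
  split_ifs <;> first | rfl | omega

lemma kil_top {n : ℕ} (w : Eu n) : kil n w = 0 := by
  ext i; simp [kil_apply]

lemma no_regular_ultra {n : ℕ} (𝒰 : Ultrafilter (Eu n)) (hU : (𝒰 : Filter (Eu n)) ≤ 𝓝 0)
    (hne : ∀ᶠ x in (𝒰 : Filter (Eu n)), x ≠ 0) (f : Fin n → A0 n)
    (hf : ∀ i, ∀ᶠ x in (𝒰 : Filter (Eu n)), (f i).1 x = 0)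
    (hdet : ∀ᶠ x in (𝒰 : Filter (Eu n)), (Matrix.of fun i j => (D j (f i)).1 x).det ≠ 0) :
    False := by
  have hana : ∀ g : A0 n, ∀ᶠ x in (𝒰 : Filter (Eu n)), AnalyticAt ℝ g.1 x := fun g =>
    hU (AnalyticAt.eventually_analyticAt g.2)
  have hex : ∀ x : Eu n, ∃ ψ : Eu n → Eu n, ((∀ i, AnalyticAt ℝ (f i).1 x) → (∀ i, (f i).1 x = 0) →
      (Matrix.of fun i j => (D j (f i)).1 x).det ≠ 0 →
      AnalyticAt ℝ ψ 0 ∧ ψ 0 = x ∧ ∀ᶠ w in 𝓝 0, ∀ i, (f i).1 (ψ w) = w i) := by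
    intro x
    by_cases h : (∀ i, AnalyticAt ℝ (f i).1 x) ∧ (∀ i, (f i).1 x = 0) ∧
      (Matrix.of fun i j => (D j (f i)).1 x).det ≠ 0
    · obtain ⟨ψ, hψ⟩ := local_inv (f := fun i => (f i).1) h.1 h.2.1 h.2.2
      exact ⟨ψ, fun _ _ _ => hψ⟩
    · exact ⟨id, fun h1 h2 h3 => (h ⟨h1, h2, h3⟩).elim⟩
  choose ψ hψ0 using hex
  have hψ : ∀ᶠ x in (𝒰 : Filter (Eu n)), AnalyticAt ℝ (ψ x) 0 ∧ ψ x 0 = x ∧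
      ∀ᶠ w in 𝓝 0, ∀ i, (f i).1 (ψ x w) = w i := by
    filter_upwards [eventually_all.2 fun i => hana (f i), eventually_all.2 hf, hdet] with x h1 h2 h3
    exact hψ0 x h1 h2 h3
  have hk0 : ∀ k, Tendsto (kil (n := n) k) (𝓝 0) (𝓝 0) := fun k => by
    have := (kil (n := n) k).continuous.tendsto 0
    rwa [map_zero] at this
  let J : ℕ → Ideal (A0 n) := fun k =>
    { carrier := {g | ∀ᶠ x in (𝒰 : Filter (Eu n)), ∀ᶠ w in 𝓝 0, g.1 (ψ x (kil k w)) = 0}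
      add_mem' := fun {a b} ha hb => by
        filter_upwards [ha, hb] with x h1 h2
        filter_upwards [h1, h2] with w h3 h4
        simp [h3, h4]
      zero_mem' := by simp
      smul_mem' := fun c {a} ha => by
        filter_upwards [ha] with x h1
        filter_upwards [h1] with w h3
        simp [h3] }
  have hJmem : ∀ k g, g ∈ J k ↔ ∀ᶠ x in (𝒰 : Filter (Eu n)), ∀ᶠ w in 𝓝 0,
      g.1 (ψ x (kil k w)) = 0 := fun k g => Iff.rfl
  have hJ0 : ∀ k, ∀ g ∈ J k, ∀ᶠ x in (𝒰 : Filter (Eu n)), g.1 x = 0 := by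
    intro k g hg
    filter_upwards [hg, hψ] with x h1 h2
    have := h1.self_of_nhds
    rwa [map_zero, h2.2.1] at this
  refine no_chain J (fun k hk => ⟨?_, ?_⟩) (fun k hk g hg => ?_) (fun k hk => ?_) (fun g hg => ?_) ?_
  · intro h
    have h1 : (1 : A0 n) ∈ J k := by rw [h]; trivial
    obtain ⟨x, hx⟩ := (hJ0 k 1 h1).exists
    exact one_ne_zero hx
  · intro a b hab
    rw [hJmem] at hab
    rw [hJmem, hJmem, ← Ultrafilter.eventually_or]
    filter_upwards [hab, hψ, hana a, hana b] with x h1 h2 h3 h4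
    have key : ∀ g : A0 n, AnalyticAt ℝ g.1 x → AnalyticAt ℝ (fun w => g.1 (ψ x (kil k w))) 0 := by
      intro g hg
      have e1 : AnalyticAt ℝ (fun w => ψ x (kil k w)) 0 :=
        AnalyticAt.fun_comp (f := kil k) (by rw [map_zero]; exact h2.1) ((kil k).analyticAt 0)
      exact AnalyticAt.fun_comp (g := g.1) (f := fun w => ψ x (kil k w))
        (by simpa [h2.2.1] using hg) e1
    exact germ_domain (key a h3) (key b h4) h1
  · rw [hJmem]
    have h1 : ∀ᶠ x in 𝓝 0, ∀ᶠ z in 𝓝 x, g.1 z = 0 := eventually_eventually_nhds.2 hg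
    filter_upwards [hU h1, hψ] with x h2 h3
    have h4 : Tendsto (fun w => ψ x (kil k w)) (𝓝 0) (𝓝 x) := by
      have := h3.1.continuousAt.tendsto
      rw [h3.2.1] at this
      exact this.comp (hk0 k)
    exact h4.eventually h2
  · refine lt_of_le_not_ge (fun g hg => ?_) (fun hle => ?_)
    · rw [hJmem] at hg ⊢
      filter_upwards [hg] with x h1
      filter_upwards [(hk0 (k + 1)).eventually h1] with w h2
      rwa [kil_kil] at h2
    · have h1 : f ⟨k, hk⟩ ∈ J (k + 1) := by
        rw [hJmem]
        filter_upwards [hψ] with x h2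
        filter_upwards [(hk0 (k + 1)).eventually h2.2.2] with w h3
        rw [h3, kil_apply, if_pos (by simp)]
      have h2 := (hJmem _ _).1 (hle h1)
      obtain ⟨x, h3, h4⟩ := (h2.and hψ).exists
      have h5 : ∀ᶠ w : Eu n in 𝓝 0, w ⟨k, hk⟩ = 0 := by
        filter_upwards [h3, (hk0 k).eventually h4.2.2] with w h6 h7
        rw [h7, kil_apply, if_neg (by simp)] at h6
        exact h6
      have h6 : Tendsto (fun t : ℝ => EuclideanSpace.single (⟨k, hk⟩ : Fin n) t) (𝓝[≠] 0) (𝓝 0) := by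
        have : Continuous (fun t : ℝ => t • EuclideanSpace.single (⟨k, hk⟩ : Fin n) (1 : ℝ)) := by
          fun_prop
        have h := (this.tendsto 0).mono_left (nhdsWithin_le_nhds (s := {0}ᶜ))
        rw [zero_smul] at h
        refine h.congr fun t => ?_
        ext j; simp
      obtain ⟨t, h7, h8⟩ := ((h6.eventually h5).and self_mem_nhdsWithin).exists
      simp at h7
      exact h8 h7
  · have h1 := hJ0 n g hg
    have h2 : Tendsto g.1 𝒰 (𝓝 (g.1 0)) := (AnalyticAt.continuousAt g.2).tendsto.mono_left hU
    have h3 : Tendsto g.1 𝒰 (𝓝 0) := tendsto_const_nhds.congr' (h1.mono fun x hx => hx.symm)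
    exact tendsto_nhds_unique h2 h3
  · refine ⟨∑ i, crd i * crd i, ?_, fun hg => ?_⟩
    · rw [A0_sum_apply]
      refine Finset.sum_eq_zero fun i _ => ?_
      change (0 : Eu n) i * (0 : Eu n) i = 0
      simp
    · obtain ⟨x, h1, h2⟩ := ((hJ0 n _ hg).and hne).exists
      rw [A0_sum_apply] at h1
      have h3 : ∑ i, x i * x i = 0 := h1
      rw [Finset.sum_eq_zero_iff_of_nonneg fun i _ => mul_self_nonneg _] at h3
      exact h2 (by ext i; simpa using h3 i (Finset.mem_univ i))


lemma exists_det_notMem {R : Type*} [CommRing R] {n : ℕ} (P : Ideal R) [hP : P.IsPrime]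
    (G : Set (Fin n → R))
    (h : ∀ a : Fin n → R, (∀ g ∈ G, ∑ i, a i * g i ∈ P) → ∀ i, a i ∈ P) :
    ∃ g : Fin n → Fin n → R, (∀ i, g i ∈ G) ∧ (Matrix.of g).det ∉ P := by
  let K := FractionRing (R ⧸ P)
  let q : R →+* K := (algebraMap (R ⧸ P) K).comp (Ideal.Quotient.mk P)
  have hq : ∀ r, q r = 0 ↔ r ∈ P := by
    intro r
    change algebraMap (R ⧸ P) K (Ideal.Quotient.mk P r) = 0 ↔ _
    rw [map_eq_zero_iff _ (IsFractionRing.injective (R ⧸ P) K), Ideal.Quotient.eq_zero_iff_mem]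
  let m : (Fin n → R) → (Fin n → K) := fun g i => q (g i)
  have hspan : Submodule.span K (Set.image m G) = ⊤ := by
    by_contra hne
    obtain ⟨φ, hφ0, hφ⟩ := Submodule.exists_le_ker_of_lt_top _ (lt_top_iff_ne_top.2 hne)
    obtain ⟨b, hb⟩ := IsLocalization.exist_integer_multiples_of_finite
      (nonZeroDivisors (R ⧸ P)) (fun i : Fin n => φ (Pi.single i 1))
    choose s hs using hb
    choose a ha using fun i => Ideal.Quotient.mk_surjective (I := P) (s i)
    have hqa : ∀ i, q (a i) = algebraMap (R ⧸ P) K b * φ (Pi.single i 1) := by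
      intro i
      change algebraMap (R ⧸ P) K (Ideal.Quotient.mk P (a i)) = _
      rw [ha, hs, Algebra.smul_def]
    have hφe : ∀ v, φ v = ∑ i, v i * φ (Pi.single i 1) := by
      intro v
      conv_lhs => rw [← Finset.univ_sum_single v]
      rw [map_sum]
      refine Finset.sum_congr rfl fun i _ => ?_
      rw [← smul_eq_mul, ← map_smul, ← Pi.single_smul]
      simp
    have haP := h a fun g hg => by
      rw [← hq, map_sum]
      have h1 : φ (m g) = 0 := hφ (Submodule.subset_span ⟨g, hg, rfl⟩)
      rw [hφe] at h1
      calc ∑ i, q (a i * g i) = algebraMap (R ⧸ P) K b * ∑ i, m g i * φ (Pi.single i 1) := by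
            rw [Finset.mul_sum]
            refine Finset.sum_congr rfl fun i _ => ?_
            rw [map_mul, hqa]
            change _ * q (g i) = _ * (q (g i) * _)
            ring
        _ = 0 := by rw [h1, mul_zero]
    have hb0 : algebraMap (R ⧸ P) K b ≠ 0 :=
      IsLocalization.to_map_ne_zero_of_mem_nonZeroDivisors K le_rfl b.2
    apply hφ0
    ext v
    have : ∀ i, φ (Pi.single i 1) = 0 := fun i => by
      have h1 := (hq _).2 (haP i)
      rw [hqa] at h1
      exact (mul_eq_zero.1 h1).resolve_left hb0
    simp [this]
  obtain ⟨B, hBG, hBs, hBi⟩ := exists_linearIndependent K (Set.image m G)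
  rw [hspan] at hBs
  let bas : Module.Basis B K (Fin n → K) := Module.Basis.mk hBi (by simp [hBs])
  let e : B ≃ Fin n := bas.indexEquiv (Pi.basisFun K (Fin n))
  have hg : ∀ i : Fin n, ∃ g ∈ G, m g = (e.symm i : Fin n → K) := fun i => hBG (e.symm i).2
  choose g hgG hgm using hg
  refine ⟨g, hgG, fun hd => ?_⟩
  have hli : LinearIndependent K (fun i => m (g i)) := by
    have h1 : (fun i => m (g i)) = Subtype.val ∘ e.symm := funext hgm
    rw [h1]
    exact hBi.comp e.symm e.symm.injective
  have hu : IsUnit (Matrix.of fun i => m (g i)) := Matrix.linearIndependent_rows_iff_isUnit.1 hli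
  rw [Matrix.isUnit_iff_isUnit_det] at hu
  have : (Matrix.of fun i => m (g i)).det = q (Matrix.of g).det := by
    rw [RingHom.map_det]; rfl
  rw [this, (hq _).2 hd] at hu
  exact not_isUnit_zero hu


lemma flow_max {n : ℕ} {ι : Type*} [Fintype ι] (a : Eu n → Eu n) (g : ι → Eu n → ℝ)
    (u : Eu n → ℝ) (C : ι → ι → Eu n → ℝ) (y : Eu n) (ha : ContDiffAt ℝ 1 a y)
    (hg : ∀ l, ∀ᶠ z in 𝓝 y, DifferentiableAt ℝ (g l) z)
    (hC : ∀ l k, ContinuousAt (C l k) y)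
    (hXg : ∀ l, ∀ᶠ z in 𝓝 y, fderiv ℝ (g l) z (a z) = ∑ k, C l k z * g k z)
    (hy : ∀ l, g l y = 0)
    (hperp : ∀ᶠ z in 𝓝 y, (∀ l, g l z = 0) → inner ℝ z (a z) = 0)
    (hu : DifferentiableAt ℝ u y)
    (hmax : ∀ z, ‖z‖ = ‖y‖ → (∀ l, g l z = 0) → u z ≤ u y) :
    fderiv ℝ u y (a y) ≤ 0 := by
  obtain ⟨γ, hγ0, ε, hε, hγ⟩ :=
    ContDiffAt.exists_forall_mem_closedBall_exists_eq_forall_mem_Ioo_hasDerivAt₀ ha 0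
  have hγc : Tendsto γ (𝓝 0) (𝓝 y) := by
    have := (hγ 0 (by constructor <;> linarith)).continuousAt.tendsto
    rwa [hγ0] at this
  obtain ⟨K, hK0, hK⟩ : ∃ K : ℝ, 0 ≤ K ∧ ∀ᶠ z in 𝓝 y, ∀ l k, |C l k z| ≤ K := by
    refine ⟨∑ l, ∑ k, (|C l k y| + 1), by positivity, ?_⟩
    rw [eventually_all]; intro l
    rw [eventually_all]; intro k
    have h1 : ∀ᶠ z in 𝓝 y, |C l k z| < |C l k y| + 1 :=
      (hC l k).abs.eventually_lt_const (by linarith)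
    filter_upwards [h1] with z hz
    refine hz.le.trans ?_
    refine le_trans ?_ (Finset.single_le_sum (f := fun l => ∑ k, (|C l k y| + 1))
      (fun i _ => by positivity) (Finset.mem_univ l))
    exact Finset.single_le_sum (f := fun k => (|C l k y| + 1))
      (fun i _ => by positivity) (Finset.mem_univ k)
  have hall := hγc.eventually (hK.and ((eventually_all.2 hg).and ((eventually_all.2 hXg).and hperp)))
  obtain ⟨η, hη, hη1⟩ := Metric.eventually_nhds_iff_ball.1 hall
  set b := min (ε / 2) (η / 2) with hb
  have hb0 : 0 < b := by positivity
  have hbε : b < ε := lt_of_le_of_lt (min_le_left _ _) (by linarith)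
  have hbη : b < η := lt_of_le_of_lt (min_le_right _ _) (by linarith)
  have hP : ∀ t ∈ Icc 0 b, HasDerivAt γ (a (γ t)) t ∧ _ := fun t ht =>
    ⟨hγ t ⟨by linarith [ht.1], by linarith [ht.2]⟩, hη1 t (by
      rw [mem_ball, dist_zero_right, Real.norm_eq_abs, abs_of_nonneg ht.1]; linarith [ht.2])⟩
  have hGd : ∀ t ∈ Icc 0 b, HasDerivAt (fun t l => g l (γ t))
      (fun l => ∑ k, C l k (γ t) * g k (γ t)) t := by
    intro t ht
    obtain ⟨h1, h2, h3, h4, h5⟩ := hP t ht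
    rw [hasDerivAt_pi]
    intro l
    rw [← h4 l]
    exact (h3 l).hasFDerivAt.comp_hasDerivAt t h1
  have hG0 : ∀ t ∈ Icc 0 b, (fun l => g l (γ t)) = 0 := by
    refine eq_zero_of_abs_deriv_le_mul_abs_self_of_eq_zero_right (K := Fintype.card ι * K)
      (f' := fun t l => ∑ k, C l k (γ t) * g k (γ t))
      (fun t ht => (hGd t ht).continuousAt.continuousWithinAt)
      (fun t ht => (hGd t (Ico_subset_Icc_self ht)).hasDerivWithinAt) ?_ ?_
    · funext l; simp [hγ0, hy]
    · intro t ht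
      obtain ⟨h1, h2, h3, h4, h5⟩ := hP t (Ico_subset_Icc_self ht)
      rw [pi_norm_le_iff_of_nonneg (by positivity)]
      intro l
      refine (norm_sum_le _ _).trans ?_
      have : ∀ k ∈ (Finset.univ : Finset ι), ‖C l k (γ t) * g k (γ t)‖ ≤
          K * ‖(fun l => g l (γ t))‖ := fun k _ => by
        rw [norm_mul]
        exact mul_le_mul (h2 l k) (norm_le_pi_norm (fun l => g l (γ t)) k) (norm_nonneg _) hK0
      refine (Finset.sum_le_card_nsmul _ _ _ this).trans ?_
      rw [nsmul_eq_mul, Finset.card_univ, mul_assoc]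
  have hN : ∀ t ∈ Icc 0 b, ‖γ t‖ = ‖y‖ := by
    have hd : ∀ t ∈ Icc 0 b, HasDerivAt (fun t => ‖γ t‖ ^ 2) 0 t := by
      intro t ht
      obtain ⟨h1, h2, h3, h4, h5⟩ := hP t ht
      have h6 := h1.norm_sq
      rw [h5 (fun l => congrFun (hG0 t ht) l), mul_zero] at h6
      exact h6
    have hc := constant_of_has_deriv_right_zero (f := fun t => ‖γ t‖ ^ 2)
      (fun t ht => (hd t ht).continuousAt.continuousWithinAt)
      (fun t ht => (hd t (Ico_subset_Icc_self ht)).hasDerivWithinAt)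
    intro t ht
    have := hc t ht
    rw [hγ0] at this
    exact (sq_eq_sq₀ (norm_nonneg _) (norm_nonneg _)).1 this
  have hud : HasDerivAt (fun t => u (γ t)) (fderiv ℝ u y (a y)) 0 := by
    have h1 := (hP 0 ⟨le_rfl, hb0.le⟩).1
    rw [hγ0] at h1
    have h2 : HasFDerivAt u (fderiv ℝ u y) (γ 0) := by rw [hγ0]; exact hu.hasFDerivAt
    exact h2.comp_hasDerivAt 0 h1
  have hsl := (hasDerivWithinAt_iff_tendsto_slope' (s := Ioi 0) (lt_irrefl (0:ℝ))).1
    hud.hasDerivWithinAt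
  refine le_of_tendsto hsl ?_
  filter_upwards [Ioo_mem_nhdsGT hb0] with t ht
  have ht' : t ∈ Icc 0 b := Ioo_subset_Icc_self ht
  rw [slope_def_field, hγ0]
  have := hmax (γ t) (hN t ht') (fun l => congrFun (hG0 t ht') l)
  exact div_nonpos_of_nonpos_of_nonneg (by linarith) (by linarith [ht.1])


/-- The vector field with the given components. -/
def avec {n : ℕ} (a : Fin n → A0 n) (z : Eu n) : Eu n := WithLp.toLp 2 (fun i => (a i).1 z)

lemma X_apply {n : ℕ} (a : Fin n → A0 n) (f : A0 n) (z : Eu n) :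
    (∑ i, a i * D i f).1 z = fderiv ℝ f.1 z (avec a z) := by
  rw [A0_sum_apply, clm_eu]
  rfl

lemma avec_analyticAt {n : ℕ} {a : Fin n → A0 n} {z : Eu n} (h : ∀ i, AnalyticAt ℝ (a i).1 z) :
    AnalyticAt ℝ (avec a) z := by
  have : AnalyticAt ℝ (fun z i => (a i).1 z) z := AnalyticAt.pi h
  exact ((PiLp.continuousLinearEquiv 2 ℝ (fun _ : Fin n => ℝ)).symm.toContinuousLinearMap.analyticAt
      _).comp this

/-- The ideal of functions vanishing along an ultrafilter. -/
def IU {n : ℕ} (𝒰 : Ultrafilter (Eu n)) : Ideal (A0 n) where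
  carrier := {f | ∀ᶠ x in (𝒰 : Filter (Eu n)), f.1 x = 0}
  add_mem' := fun {a b} ha hb => by
    filter_upwards [ha, hb] with x h1 h2
    simp [h1, h2]
  zero_mem' := by simp
  smul_mem' := fun c {a} ha => by
    filter_upwards [ha] with x h1
    simp [h1]

lemma mem_IU {n : ℕ} {𝒰 : Ultrafilter (Eu n)} {f : A0 n} :
    f ∈ IU 𝒰 ↔ ∀ᶠ x in (𝒰 : Filter (Eu n)), f.1 x = 0 := Iff.rfl

lemma IU_prime {n : ℕ} (𝒰 : Ultrafilter (Eu n)) : (IU 𝒰).IsPrime := by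
  refine ⟨fun h => ?_, fun {a b} hab => ?_⟩
  · have h1 : (1 : A0 n) ∈ IU 𝒰 := by rw [h]; trivial
    obtain ⟨x, hx⟩ := (mem_IU.1 h1).exists
    exact one_ne_zero hx
  · rw [mem_IU, mem_IU, ← Ultrafilter.eventually_or]
    filter_upwards [mem_IU.1 hab] with x hx
    exact mul_eq_zero.1 hx

lemma Z0_le_IU {n : ℕ} {𝒰 : Ultrafilter (Eu n)} (h : (𝒰 : Filter (Eu n)) ≤ 𝓝 0) :
    Z0 n ≤ IU 𝒰 := fun _ hf => h hf

/-- Finite generation up to germs. -/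
lemma exists_gens {n : ℕ} (P : Ideal (A0 n)) (hZ : Z0 n ≤ P) :
    ∃ (m : ℕ) (g : Fin m → A0 n), (∀ l, g l ∈ P) ∧
      ∀ f ∈ P, ∃ c : Fin m → A0 n, ∀ᶠ z in 𝓝 0, f.1 z = ∑ l, (c l).1 z * (g l).1 z := by
  obtain ⟨m, s, hs⟩ := Submodule.fg_iff_exists_fin_generating_family.1
    (IsNoetherian.noetherian (P.map (pr n)))
  choose g hg using fun l => pr_surj n (s l)
  refine ⟨m, g, fun l => ?_, fun f hf => ?_⟩
  · rw [← mem_map_pr P hZ, hg, ← hs]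
    exact Submodule.subset_span ⟨l, rfl⟩
  · have h1 : pr n f ∈ Ideal.span (range s) := by
      have : pr n f ∈ P.map (pr n) := (mem_map_pr P hZ f).2 hf
      rw [← hs] at this
      exact this
    obtain ⟨c, hc⟩ := Ideal.mem_span_range_iff_exists_fun.1 h1
    choose c' hc' using fun l => pr_surj n (c l)
    refine ⟨c', ?_⟩
    have h2 : pr n f = pr n (∑ l, c' l * g l) := by
      rw [map_sum, ← hc]
      simp [hc', hg]
    filter_upwards [pr_eq.1 h2] with z hz
    rw [hz, A0_sum_apply]
    rfl

lemma exists_max_IU {n : ℕ} (𝓕 : Filter (Eu n)) [𝓕.NeBot] (h𝓕 : 𝓕 ≤ 𝓝 0) :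
    ∃ 𝒰 : Ultrafilter (Eu n), (𝒰 : Filter (Eu n)) ≤ 𝓕 ∧
      ∀ 𝒱 : Ultrafilter (Eu n), (𝒱 : Filter (Eu n)) ≤ 𝓕 → IU 𝒰 ≤ IU 𝒱 → IU 𝒱 ≤ IU 𝒰 := by
  let S : Set (Ideal (AG n)) :=
    {I | ∃ 𝒰 : Ultrafilter (Eu n), (𝒰 : Filter (Eu n)) ≤ 𝓕 ∧ I = (IU 𝒰).map (pr n)}
  have hS : S.Nonempty := ⟨_, Ultrafilter.of 𝓕, Ultrafilter.of_le 𝓕, rfl⟩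
  obtain ⟨I, ⟨𝒰, hU, rfl⟩, hmax⟩ := set_has_maximal_iff_noetherian.2
    (inferInstance : IsNoetherian (AG n) (AG n)) S hS
  refine ⟨𝒰, hU, fun 𝒱 hV hle f hf => ?_⟩
  have h1 := hmax _ ⟨𝒱, hV, rfl⟩
  have h2 : (IU 𝒰).map (pr n) ≤ (IU 𝒱).map (pr n) := Ideal.map_mono hle
  have h3 : (IU 𝒱).map (pr n) ≤ (IU 𝒰).map (pr n) := by
    by_contra h4
    exact h1 (lt_of_le_not_ge h2 h4)
  rw [← mem_map_pr _ (Z0_le_IU (hU.trans h𝓕))]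
  exact h3 ((mem_map_pr _ (Z0_le_IU (hV.trans h𝓕)) f).2 hf)

/-- The bad set. -/
def Bad {n N : ℕ} (F : Fin N → A0 n) (Δ δ : A0 n) : Set (Eu n) :=
  {x | x ≠ 0 ∧ (∀ i, (F i).1 x = 0) ∧ Δ.1 x = 0 ∧ δ.1 x ≠ 0}

lemma step1 {n N : ℕ} (F : Fin N → A0 n) (Δ δ : A0 n)
    (hperp : ∀ᶠ z in 𝓝 (0 : Eu n), δ.1 z ≠ 0 → Δ.1 z = 0 →
      ∀ v, (∀ i, fderiv ℝ (F i).1 z v = 0) → inner ℝ z v = 0)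
    (𝒰 : Ultrafilter (Eu n)) (hU : (𝒰 : Filter (Eu n)) ≤ 𝓝 0 ⊓ 𝓟 (Bad F Δ δ))
    (hmax : ∀ 𝒱 : Ultrafilter (Eu n), (𝒱 : Filter (Eu n)) ≤ 𝓝 0 ⊓ 𝓟 (Bad F Δ δ) →
      IU 𝒰 ≤ IU 𝒱 → IU 𝒱 ≤ IU 𝒰)
    (a : Fin n → A0 n) (ha : ∀ f ∈ IU 𝒰, ∑ i, a i * D i f ∈ IU 𝒰)
    (v : A0 n) (hv : v.1 0 ≠ 0) : ∑ i, a i * D i (δ * v) ∈ IU 𝒰 := by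
  have hU0 : (𝒰 : Filter (Eu n)) ≤ 𝓝 0 := hU.trans inf_le_left
  have hUB : ∀ᶠ x in (𝒰 : Filter (Eu n)), x ∈ Bad F Δ δ := (hU.trans inf_le_right) (mem_principal_self _)
  obtain ⟨m, g, hgP, hgen⟩ := exists_gens (IU 𝒰) (Z0_le_IU hU0)
  have hFP : ∀ i, F i ∈ IU 𝒰 := fun i => mem_IU.2 (hUB.mono fun x hx => hx.2.1 i)
  have hΔP : Δ ∈ IU 𝒰 := mem_IU.2 (hUB.mono fun x hx => hx.2.2.1)
  choose C hC using fun l => hgen _ (ha _ (hgP l))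
  choose CF hCF using fun i => hgen _ (hFP i)
  choose CX hCX using fun i => hgen _ (ha _ (hFP i))
  obtain ⟨CD, hCD⟩ := hgen _ hΔP
  have han : ∀ f : A0 n, ∀ᶠ z in 𝓝 0, AnalyticAt ℝ f.1 z := fun f =>
    AnalyticAt.eventually_analyticAt f.2
  obtain ⟨r, hr, hball⟩ := Metric.eventually_nhds_iff_ball.1
    ((eventually_all.2 hC).and ((eventually_all.2 hCF).and ((eventually_all.2 hCX).and (hCD.and
    (hperp.and ((eventually_all.2 fun i => han (a i)).and ((eventually_all.2 fun i => han (g i)).and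
    ((eventually_all.2 fun l => eventually_all.2 fun k => han (C l k)).and
    ((han δ).and (han (δ * v)))))))))))
  -- the pointwise statement
  have hpt : ∀ x : Eu n, ∃ y : Eu n, (x ∈ ball (0 : Eu n) r → x ≠ 0 → (∀ l, (g l).1 x = 0) →
      (δ * v).1 x ≠ 0 → ‖y‖ = ‖x‖ ∧ (∀ l, (g l).1 y = 0) ∧ y ∈ Bad F Δ δ ∧
        fderiv ℝ (δ * v).1 y (avec a y) = 0) := by
    intro x
    by_cases hx : x ∈ ball (0 : Eu n) r ∧ x ≠ 0 ∧ (∀ l, (g l).1 x = 0) ∧ (δ * v).1 x ≠ 0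
    swap
    · exact ⟨0, fun h1 h2 h3 h4 => (hx ⟨h1, h2, h3, h4⟩).elim⟩
    obtain ⟨hxr, hx0, hxg, hxu⟩ := hx
    have hxr' : ‖x‖ < r := by simpa using hxr
    have hsub : sphere (0 : Eu n) ‖x‖ ⊆ ball 0 r := fun z hz => by
      rw [mem_sphere_zero_iff_norm] at hz
      rw [mem_ball_zero_iff, hz]; exact hxr'
    let S : Set (Eu n) := sphere (0 : Eu n) ‖x‖ ∩ ⋂ l, {z ∈ sphere (0 : Eu n) ‖x‖ | (g l).1 z = 0}
    have hScl : IsClosed (⋂ l, {z ∈ sphere (0 : Eu n) ‖x‖ | (g l).1 z = 0}) := by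
      refine isClosed_iInter fun l => ?_
      have hc : ContinuousOn (g l).1 (sphere (0 : Eu n) ‖x‖) := fun z hz =>
        ((hball z (hsub hz)).2.2.2.2.2.2.1 l).continuousAt.continuousWithinAt
      exact hc.preimage_isClosed_of_isClosed isClosed_sphere isClosed_singleton
    have hScomp : IsCompact S := (isCompact_sphere 0 ‖x‖).inter_right hScl
    have hxS : x ∈ S := ⟨by simp, mem_iInter.2 fun l => ⟨by simp, hxg l⟩⟩
    have huc : ContinuousOn (fun z => (δ * v).1 z ^ 2) S := fun z hz =>
      ((hball z (hsub hz.1)).2.2.2.2.2.2.2.2.2.continuousAt.pow 2).continuousWithinAt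
    obtain ⟨y, hyS, hymax⟩ := hScomp.exists_isMaxOn ⟨x, hxS⟩ huc
    have hyn : ‖y‖ = ‖x‖ := by simpa using hyS.1
    have hyr : y ∈ ball (0 : Eu n) r := hsub hyS.1
    have hyg : ∀ l, (g l).1 y = 0 := fun l => (mem_iInter.1 hyS.2 l).2
    have hyu : (δ * v).1 y ≠ 0 := by
      intro h0
      have h1 : (δ * v).1 x ^ 2 ≤ (δ * v).1 y ^ 2 := hymax hxS
      rw [h0] at h1
      have : 0 < (δ * v).1 x ^ 2 := by positivity
      linarith
    have hyδ : δ.1 y ≠ 0 := fun h0 => hyu (by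
      change δ.1 y * v.1 y = 0
      rw [h0, zero_mul])
    obtain ⟨b1, b2, b3, b4, b5, b6, b7, b8, b9, b10⟩ := hball y hyr
    have hnear : ∀ᶠ z in 𝓝 y, z ∈ ball (0 : Eu n) r := isOpen_ball.mem_nhds hyr
    refine ⟨y, fun _ _ _ _ => ⟨hyn, hyg, ⟨?_, ?_, ?_, hyδ⟩, ?_⟩⟩
    · rw [← norm_ne_zero_iff, hyn, norm_ne_zero_iff]; exact hx0
    · intro i; rw [b2 i]; simp [hyg]
    · rw [b4]; simp [hyg]
    · have hdiff : DifferentiableAt ℝ (fun z => (δ * v).1 z ^ 2) y := b10.differentiableAt.pow 2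
      have hfd : ∀ w, fderiv ℝ (fun z => (δ * v).1 z ^ 2) y w =
          2 * (δ * v).1 y * fderiv ℝ (δ * v).1 y w := by
        intro w
        have := b10.differentiableAt.hasFDerivAt.pow 2
        rw [this.fderiv]
        simp
      have hmx : ∀ z : Eu n, ‖z‖ = ‖y‖ → (∀ l, (g l).1 z = 0) →
          (δ * v).1 z ^ 2 ≤ (δ * v).1 y ^ 2 := by
        intro z hz hzg
        have hzs : z ∈ sphere (0 : Eu n) ‖x‖ := by simp [hz, hyn]
        exact hymax (show z ∈ S from ⟨hzs, mem_iInter.2 fun l => ⟨hzs, hzg l⟩⟩)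
      have hper : ∀ᶠ z in 𝓝 y, (∀ l, (g l).1 z = 0) → inner ℝ z (avec a z) = 0 := by
        filter_upwards [hnear, b9.continuousAt.eventually_ne hyδ] with z hz hzδ hzg
        obtain ⟨c1, c2, c3, c4, c5, c6⟩ := hball z hz
        refine c5 hzδ (by rw [c4]; simp [hzg]) _ fun i => ?_
        rw [← X_apply, c3 i]; simp [hzg]
      have hXg : ∀ l, ∀ᶠ z in 𝓝 y, fderiv ℝ (g l).1 z (avec a z) =
          ∑ k, (C l k).1 z * (g k).1 z := by
        intro l
        filter_upwards [hnear] with z hz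
        rw [← X_apply]
        exact (hball z hz).1 l
      have hgd : ∀ l, ∀ᶠ z in 𝓝 y, DifferentiableAt ℝ (g l).1 z := fun l => by
        filter_upwards [hnear] with z hz
        exact ((hball z hz).2.2.2.2.2.2.1 l).differentiableAt
      have hav := (avec_analyticAt b6).contDiffAt (n := 1)
      have e1 := flow_max (avec a) (fun l => (g l).1) (fun z => (δ * v).1 z ^ 2)
        (fun l k => (C l k).1) y hav hgd (fun l k => (b8 l k).continuousAt) hXg hyg hper hdiff hmx
      have e2 := flow_max (fun z => - avec a z) (fun l => (g l).1) (fun z => (δ * v).1 z ^ 2)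
        (fun l k z => - (C l k).1 z) y hav.neg hgd (fun l k => (b8 l k).continuousAt.neg)
        (fun l => by
          filter_upwards [hXg l] with z hz
          rw [map_neg, hz]
          simp) hyg
        (by
          filter_upwards [hper] with z hz hzg
          rw [inner_neg_right, hz hzg, neg_zero]) hdiff hmx
      rw [map_neg] at e2
      rw [hfd] at e1 e2
      have e3 : 2 * (δ * v).1 y * fderiv ℝ (δ * v).1 y (avec a y) = 0 := by linarith
      exact (mul_eq_zero.1 e3).resolve_left (mul_ne_zero two_ne_zero hyu)
  choose y hy using hpt
  have hyU : ∀ᶠ x in (𝒰 : Filter (Eu n)), ‖y x‖ = ‖x‖ ∧ (∀ l, (g l).1 (y x) = 0) ∧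
      y x ∈ Bad F Δ δ ∧ fderiv ℝ (δ * v).1 (y x) (avec a (y x)) = 0 := by
    have h1 : ∀ᶠ x in (𝒰 : Filter (Eu n)), v.1 x ≠ 0 :=
      hU0 ((AnalyticAt.continuousAt v.2).eventually_ne hv)
    have h2 : ∀ᶠ x in (𝒰 : Filter (Eu n)), ∀ l, (g l).1 x = 0 := eventually_all.2 hgP
    filter_upwards [hU0 (ball_mem_nhds 0 hr), hUB, h1, h2] with x h3 h4 h5 h6
    exact hy x h3 h4.1 h6 (mul_ne_zero h4.2.2.2 h5)
  have hyt : Tendsto y 𝒰 (𝓝 0) := by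
    rw [tendsto_zero_iff_norm_tendsto_zero]
    have h1 : Tendsto (fun x : Eu n => ‖x‖) 𝒰 (𝓝 0) := tendsto_norm_zero.mono_left hU0
    exact h1.congr' (hyU.mono fun x hx => hx.1.symm)
  have hV : ((𝒰.map y : Ultrafilter (Eu n)) : Filter (Eu n)) ≤ 𝓝 0 ⊓ 𝓟 (Bad F Δ δ) := by
    rw [Ultrafilter.coe_map]
    refine le_inf hyt (le_principal_iff.2 ?_)
    exact hyU.mono fun x hx => hx.2.2.1
  refine hmax (𝒰.map y) hV (fun f hf => ?_) ?_
  · obtain ⟨c, hc⟩ := hgen f hf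
    change ∀ᶠ x in (𝒰 : Filter (Eu n)), f.1 (y x) = 0
    filter_upwards [hyt.eventually hc, hyU] with x h1 h2
    rw [h1]; simp [h2.2.1]
  · change ∀ᶠ x in (𝒰 : Filter (Eu n)), (∑ i, a i * D i (δ * v)).1 (y x) = 0
    filter_upwards [hyU] with x h2
    rw [X_apply]; exact h2.2.2.2

theorem key {n N : ℕ} (F : Fin N → A0 n) (Δ δ : A0 n)
    (hperp : ∀ᶠ z in 𝓝 (0 : Eu n), δ.1 z ≠ 0 → Δ.1 z = 0 →
      ∀ v, (∀ i, fderiv ℝ (F i).1 z v = 0) → inner ℝ z v = 0) :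
    ∀ᶠ x in 𝓝 (0 : Eu n), x ∉ Bad F Δ δ := by
  by_contra hcon
  have hne : (𝓝 (0 : Eu n) ⊓ 𝓟 (Bad F Δ δ)).NeBot := by
    rw [← frequently_mem_iff_neBot]
    have := not_eventually.1 hcon
    simpa using this
  obtain ⟨𝒰, hU, hmax⟩ := exists_max_IU (𝓝 (0 : Eu n) ⊓ 𝓟 (Bad F Δ δ)) inf_le_left
  have hU0 : (𝒰 : Filter (Eu n)) ≤ 𝓝 0 := hU.trans inf_le_left
  have hUB : ∀ᶠ x in (𝒰 : Filter (Eu n)), x ∈ Bad F Δ δ := (hU.trans inf_le_right) (mem_principal_self _)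
  have hstep2 : ∀ a : Fin n → A0 n, (∀ f ∈ IU 𝒰, ∑ i, a i * D i f ∈ IU 𝒰) → ∀ i, a i ∈ IU 𝒰 := by
    intro a ha i
    have h1 := step1 F Δ δ hperp 𝒰 hU hmax a ha 1 (one_ne_zero (α := ℝ))
    have h2 := step1 F Δ δ hperp 𝒰 hU hmax a ha (1 + crd i) (by
      change (1 : ℝ) + (0 : Eu n) i ≠ 0
      simp)
    have h3 : ∀ᶠ z in (𝒰 : Filter (Eu n)), AnalyticAt ℝ δ.1 z :=
      hU0 (AnalyticAt.eventually_analyticAt δ.2)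
    rw [mem_IU] at h1 h2 ⊢
    filter_upwards [h1, h2, h3, hUB] with x k1 k2 k3 k4
    rw [X_apply, mul_one] at k1
    rw [X_apply] at k2
    have hp := (EuclideanSpace.proj (𝕜 := ℝ) i : Eu n →L[ℝ] ℝ).hasFDerivAt (x := x)
    have hm := k3.differentiableAt.hasFDerivAt.mul ((hasFDerivAt_const (1 : ℝ) x).add hp)
    have hm' : HasFDerivAt (δ * (1 + crd i)).1 _ x := hm
    rw [hm'.fderiv] at k2
    simp [k1] at k2
    rcases k2 with k2 | k2
    · exact (k4.2.2.2 k2).elim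
    · exact k2
  have := IU_prime 𝒰
  obtain ⟨G, hG, hdet⟩ := exists_det_notMem (IU 𝒰)
    {w : Fin n → A0 n | ∃ f ∈ IU 𝒰, w = fun i => D i f} (fun a h => hstep2 a fun f hf =>
      h _ ⟨f, hf, rfl⟩)
  choose f hf hfG using hG
  refine no_regular_ultra 𝒰 hU0 (hUB.mono fun x hx => hx.1) f (fun i => hf i) ?_
  rw [mem_IU, ← Ultrafilter.eventually_not] at hdet
  filter_upwards [hdet] with x hx
  have h1 : (Matrix.of G).det.1 x = (Matrix.of fun i j => (D j (f i)).1 x).det := by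
    let ev : A0 n →+* ℝ := (Pi.evalRingHom (fun _ : Eu n => ℝ) x).comp (A0 n).subtype
    change ev (Matrix.of G).det = _
    rw [RingHom.map_det]
    congr 1
    ext i j
    change (G i j).1 x = (D j (f i)).1 x
    rw [hfG]
  rwa [← h1]


/-- The Gram determinant. -/
def gram {ι : Type*} [Fintype ι] [DecidableEq ι] {R : Type*} [CommRing R] {n : ℕ}
    (B : Matrix ι (Fin n) R) : R := (B * B.transpose).det

lemma gram_apply {ι : Type*} [Fintype ι] [DecidableEq ι] {n m : ℕ}
    (B : Matrix ι (Fin n) (A0 m)) (x : Eu m) :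
    (gram B).1 x = gram (Matrix.of fun i j => (B i j).1 x) := by
  let ev : A0 m →+* ℝ := (Pi.evalRingHom (fun _ : Eu m => ℝ) x).comp (A0 m).subtype
  change ev (gram B) = _
  rw [gram, RingHom.map_det, gram, RingHom.mapMatrix_apply, Matrix.map_mul, Matrix.transpose_map]
  rfl

lemma gram_eq_zero {ι : Type*} [Fintype ι] [DecidableEq ι] {n : ℕ} {B : Matrix ι (Fin n) ℝ} :
    gram B = 0 ↔ ∃ c : ι → ℝ, c ≠ 0 ∧ ∀ j, ∑ i, c i * B i j = 0 := by
  rw [gram, ← Matrix.exists_vecMul_eq_zero_iff]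
  refine exists_congr fun c => and_congr_right fun _ => ?_
  have h := Matrix.vecMul_self_mul_conjTranspose_eq_zero B c
  rw [Matrix.conjTranspose_eq_transpose_of_trivial] at h
  rw [h]
  exact funext_iff

lemma gram_surj {ι : Type*} [Fintype ι] [DecidableEq ι] {n : ℕ} {B : Matrix ι (Fin n) ℝ}
    (h : gram B ≠ 0) (w : ι → ℝ) : ∃ v : Fin n → ℝ, B.mulVec v = w := by
  refine ⟨B.transpose.mulVec ((B * B.transpose)⁻¹.mulVec w), ?_⟩
  rw [Matrix.mulVec_mulVec, Matrix.mulVec_mulVec,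
    Matrix.mul_nonsing_inv _ (isUnit_iff_ne_zero.2 h), Matrix.one_mulVec]

theorem main {M N : ℕ} (F : Eu M → Eu N) (hF : AnalyticAt ℝ F 0) :
    ∀ᶠ x in 𝓝 (0 : Eu M), x ≠ 0 → F x = 0 →
        Function.Surjective ⇑(fderiv ℝ F x) → x ∉ MilnorSet F := by
  let f : Fin N → A0 M := fun i => ⟨fun x => F x i,
    ((EuclideanSpace.proj (𝕜 := ℝ) i : Eu N →L[ℝ] ℝ).analyticAt _).comp hF⟩
  let A : Matrix (Fin N) (Fin M) (A0 M) := Matrix.of fun i j => D j (f i)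
  let B : Matrix (Fin N ⊕ Unit) (Fin M) (A0 M) := Matrix.of fun i j =>
    Sum.elim (fun i => D j (f i)) (fun _ => crd j) i
  have hfd : ∀ x, AnalyticAt ℝ F x → ∀ i v, fderiv ℝ (f i).1 x v = fderiv ℝ F x v i := by
    intro x hx i v
    have h2 := (EuclideanSpace.proj (𝕜 := ℝ) i).hasFDerivAt.comp x hx.differentiableAt.hasFDerivAt
    have h3 : fderiv ℝ (f i).1 x = (EuclideanSpace.proj (𝕜 := ℝ) i).comp (fderiv ℝ F x) := h2.fderiv
    rw [h3]; rfl
  have hsum : ∀ (i : Fin N) (x v : Eu M), ∑ j, (D j (f i)).1 x * v j = fderiv ℝ (f i).1 x v := by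
    intro i x v
    rw [clm_eu]
    exact Finset.sum_congr rfl fun j _ => by rw [D_apply, smul_eq_mul, mul_comm]
  have hin : ∀ x v : Eu M, ∑ j, x j * v j = inner ℝ x v := by
    intro x v
    rw [PiLp.inner_apply]
    exact Finset.sum_congr rfl fun j _ => by simp [mul_comm]
  have hperp : ∀ᶠ z in 𝓝 (0 : Eu M), (gram A).1 z ≠ 0 → (gram B).1 z = 0 →
      ∀ v, (∀ i, fderiv ℝ (f i).1 z v = 0) → inner ℝ z v = 0 := by
    refine Eventually.of_forall fun z hA hB v hv => ?_
    rw [gram_apply, gram_eq_zero] at hB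
    obtain ⟨c, hc0, hc⟩ := hB
    simp only [Fintype.sum_sum_type] at hc
    by_cases hcs : c (Sum.inr ()) = 0
    · refine (hA ?_).elim
      rw [gram_apply, gram_eq_zero]
      refine ⟨fun i => c (Sum.inl i), fun h => hc0 ?_, fun j => ?_⟩
      · funext i
        rcases i with i | i
        · exact congrFun h i
        · exact hcs
      · have := hc j
        simp only [hcs, zero_mul, Finset.sum_const_zero, add_zero] at this
        exact this
    · have h1 : ∑ j, (∑ i, c (Sum.inl i) * (D j (f i)).1 z + c (Sum.inr ()) * z j) * v j = 0 := by
        refine Finset.sum_eq_zero fun j _ => ?_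
        have := hc j
        simp only [Finset.univ_unique, Finset.sum_singleton] at this
        have h2 : ∑ i, c (Sum.inl i) * (D j (f i)).1 z + c (Sum.inr ()) * z j = 0 := this
        rw [h2, zero_mul]
      simp only [add_mul, Finset.sum_add_distrib, Finset.sum_mul] at h1
      rw [Finset.sum_comm] at h1
      have h2 : ∀ i, ∑ j, c (Sum.inl i) * (D j (f i)).1 z * v j = 0 := by
        intro i
        simp only [mul_assoc]
        rw [← Finset.mul_sum, hsum, hv, mul_zero]
      simp only [h2, Finset.sum_const_zero, zero_add] at h1
      simp only [mul_assoc] at h1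
      rw [← Finset.mul_sum, hin] at h1
      exact (mul_eq_zero.1 h1).resolve_left hcs
  filter_upwards [key f (gram B) (gram A) hperp, hF.eventually_analyticAt] with x hx hax hx0 hFx hsurj hM
  refine hx ⟨hx0, fun i => ?_, ?_, ?_⟩
  · change F x i = 0
    rw [hFx]; rfl
  · by_contra hB
    rw [gram_apply] at hB
    apply hM
    have hd : HasFDerivAt (fun y => (F y, ‖y‖ ^ 2)) _ x :=
      hax.differentiableAt.hasFDerivAt.prodMk (hasStrictFDerivAt_norm_sq x).hasFDerivAt
    rw [hd.fderiv]
    rintro ⟨w, s⟩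
    obtain ⟨v, hv⟩ := gram_surj hB (Sum.elim (fun i => w i) (fun _ => s / 2))
    refine ⟨WithLp.toLp 2 v, ?_⟩
    have h1 : fderiv ℝ F x (WithLp.toLp 2 v) = w := by
      ext i
      rw [← hfd x hax, ← hsum]
      exact congrFun hv (Sum.inl i)
    have h2 : inner ℝ x (WithLp.toLp 2 v) = s / 2 := by
      rw [← hin]
      exact congrFun hv (Sum.inr ())
    refine Prod.ext h1 ?_
    change (2 • (innerSL ℝ x)) (WithLp.toLp 2 v) = s
    have h3 : (2 • (innerSL ℝ x)) (WithLp.toLp 2 v) = 2 * inner ℝ x (WithLp.toLp 2 v) := by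
      simp
    rw [h3, h2]; ring
  · intro hA
    rw [gram_apply, gram_eq_zero] at hA
    obtain ⟨c, hc0, hc⟩ := hA
    obtain ⟨v, hv⟩ := hsurj (WithLp.toLp 2 c)
    apply hc0
    have h1 : ∑ j, (∑ i, c i * (D j (f i)).1 x) * v j = 0 :=
      Finset.sum_eq_zero fun j _ => by
        have h2 : ∑ i, c i * (D j (f i)).1 x = 0 := hc j
        rw [h2, zero_mul]
    simp only [Finset.sum_mul] at h1
    rw [Finset.sum_comm] at h1
    have h2 : ∀ i, ∑ j, c i * (D j (f i)).1 x * v j = c i * c i := by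
      intro i
      simp only [mul_assoc]
      rw [← Finset.mul_sum, hsum, hfd x hax, hv]
    simp only [h2] at h1
    rw [Finset.sum_eq_zero_iff_of_nonneg fun i _ => mul_self_nonneg _] at h1
    funext i
    simpa using h1 i (Finset.mem_univ i)

end MilnorAux

/-- Near the origin, the smooth part V_F \ Sing F of the zero set of F is
transverse to every sphere centered at the origin: there exists ε > 0 with B_ε ⊆ U such
that no x ∈ B_ε \ {0} with F(x) = 0 and dF(x) surjective belongs to the Milnor set M(F). -/
theorem stmt_16 {M N : ℕ} (hMN : M ≥ N) (hN2 : N ≥ 2)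
    (U : Set (EuclideanSpace ℝ (Fin M)))
    (hUopen : IsOpen U) (hU0 : (0 : EuclideanSpace ℝ (Fin M)) ∈ U)
    (F : EuclideanSpace ℝ (Fin M) → EuclideanSpace ℝ (Fin N))
    (hF : AnalyticOnNhd ℝ F U) (hF0 : F 0 = 0) :
    ∃ ε > 0, ball (0 : EuclideanSpace ℝ (Fin M)) ε ⊆ U ∧
      ∀ x ∈ ball (0 : EuclideanSpace ℝ (Fin M)) ε, x ≠ 0 → F x = 0 →
        Function.Surjective ⇑(fderiv ℝ F x) → x ∉ MilnorSet F := by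
  obtain ⟨ε, hε, h⟩ := Metric.eventually_nhds_iff_ball.1
    ((hUopen.eventually_mem hU0).and (MilnorAux.main F (hF 0 hU0)))
  exact ⟨ε, hε, fun x hx => (h x hx).1, fun x hx => (h x hx).2⟩
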